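/- Let n ≥ 2 and for each natural number L let a(L) denote the (finite) number of fully commutative involutions of Coxeter length L in the affine Coxeter group of type D̃_{n+2}. Then the sequence (a(L)) is ultimately periodic with period dividing 2n+2: there exists N such that a(L + 2n + 2) = a(L) for all L ≥ N. -/

import Mathlib

open CoxeterSystem

/-- A single commutation move: transposition of two adjacent letters `a`, `b`
with `M a b = 2`. -/
def CommMove {B : Type*} (M : CoxeterMatrix B) (w w' : List B) : Prop :=
  ∃ (u v : List B) (a b : B), M a b = 2 ∧ w = u ++ a :: b :: v ∧ w' = u ++ b :: a :: v

/-- Commutation equivalence of words: two words are commutation-equivalent if one can be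
obtained from the other by a sequence of transpositions of adjacent commuting letters. -/
def CommEquiv {B : Type*} (M : CoxeterMatrix B) : List B → List B → Prop :=
  Relation.EqvGen (CommMove M)

/-- An element is fully commutative if all its reduced words are commutation-equivalent. -/
def IsFullyCommutative {B W : Type*} [Group W] {M : CoxeterMatrix B}
    (cs : CoxeterSystem M W) (w : W) : Prop :=
  ∀ u v : List B, cs.IsReduced u → cs.wordProd u = w →
    cs.IsReduced v → cs.wordProd v = w → CommEquiv M u v

/-- A fully commutative involution (the identity is allowed). -/
def IsFCInvolution {B W : Type*} [Group W] {M : CoxeterMatrix B}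
    (cs : CoxeterSystem M W) (w : W) : Prop :=
  IsFullyCommutative cs w ∧ w * w = 1

set_option maxHeartbeats 1000000 in
/-- The Coxeter matrix of affine type `D̃_{n+2}` (for `n ≥ 2`): the `n + 3` generators
`u, u', s_1, …, s_{n-1}, v, v'` are indexed by `Fin (n+3)`, with index `0` corresponding
to `u`, index `1` to `u'`, index `k + 1` to `s_k` for `1 ≤ k ≤ n-1`, index `n+1` to `v`
and index `n+2` to `v'`. Here `s_1, …, s_{n-1}` form a path with `m(s_i, s_{i+1}) = 3`
for `1 ≤ i ≤ n-2`; the fork vertices `u, u'` are joined to `s_1` with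
`m(u, s_1) = m(u', s_1) = 3` and `m(u, u') = 2`; the fork vertices `v, v'` are joined
to `s_{n-1}` with `m(v, s_{n-1}) = m(v', s_{n-1}) = 3` and `m(v, v') = 2`; and `m = 2`
for all other pairs of distinct generators. -/
def affineD (n : ℕ) : CoxeterMatrix (Fin (n + 3)) where
  M := Matrix.of fun i j : Fin (n + 3) =>
    if (i : ℕ) = (j : ℕ) then 1
    else if ((i : ℕ) = 0 ∧ (j : ℕ) = 2) ∨ ((j : ℕ) = 0 ∧ (i : ℕ) = 2)
        ∨ ((i : ℕ) = 1 ∧ (j : ℕ) = 2) ∨ ((j : ℕ) = 1 ∧ (i : ℕ) = 2)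
        ∨ ((i : ℕ) + 1 = (j : ℕ) ∧ 2 ≤ (i : ℕ) ∧ (j : ℕ) ≤ n)
        ∨ ((j : ℕ) + 1 = (i : ℕ) ∧ 2 ≤ (j : ℕ) ∧ (i : ℕ) ≤ n)
        ∨ ((i : ℕ) = n ∧ ((j : ℕ) = n + 1 ∨ (j : ℕ) = n + 2))
        ∨ ((j : ℕ) = n ∧ ((i : ℕ) = n + 1 ∨ (i : ℕ) = n + 2)) then 3
    else 2
  isSymm := by
    ext i j
    simp only [Matrix.transpose_apply, Matrix.of_apply]
    split_ifs <;> omega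
  diagonal := by intro i; simp [Matrix.of_apply]
  off_diagonal := by
    intro i j hij
    have h : (i : ℕ) ≠ (j : ℕ) := fun h => hij (Fin.ext h)
    simp only [Matrix.of_apply]
    split_ifs <;> omega

namespace CommEquiv

variable {B : Type*} {M : CoxeterMatrix B}

theorem refl (w : List B) : CommEquiv M w w := Relation.EqvGen.refl w

theorem symm {w w' : List B} (h : CommEquiv M w w') : CommEquiv M w' w :=
  Relation.EqvGen.symm _ _ h

theorem trans {w w' w'' : List B} (h : CommEquiv M w w') (h' : CommEquiv M w' w'') :
    CommEquiv M w w'' := Relation.EqvGen.trans _ _ _ h h'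

/-- To transport a reflexive, symmetric, transitive relation along commutation equivalence it is
enough to treat a single move. -/
theorem lift {α : Type*} (r : α → α → Prop) (hr : Equivalence r) (f : List B → α)
    (h : ∀ w w', CommMove M w w' → r (f w) (f w')) {w w' : List B} (hw : CommEquiv M w w') :
    r (f w) (f w') := by
  induction hw with
  | rel _ _ h' => exact h _ _ h'
  | refl _ => exact hr.refl _
  | symm _ _ _ ih => exact hr.symm ih
  | trans _ _ _ _ _ ih₁ ih₂ => exact hr.trans ih₁ ih₂

theorem swap (p q : List B) {a b : B} (h : M a b = 2) :
    CommEquiv M (p ++ a :: b :: q) (p ++ b :: a :: q) :=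
  Relation.EqvGen.rel _ _ ⟨p, q, a, b, h, rfl, rfl⟩

theorem equivalence : Equivalence (CommEquiv M) := ⟨refl, symm, trans⟩

theorem append_left (p : List B) {w w' : List B} (h : CommEquiv M w w') :
    CommEquiv M (p ++ w) (p ++ w') := by
  refine lift (CommEquiv M) equivalence (fun w => p ++ w) ?_ h
  rintro _ _ ⟨u, v, a, b, hab, rfl, rfl⟩
  simpa using swap (p ++ u) v hab

theorem append_right (p : List B) {w w' : List B} (h : CommEquiv M w w') :
    CommEquiv M (w ++ p) (w' ++ p) := by
  refine lift (CommEquiv M) equivalence (fun w => w ++ p) ?_ h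
  rintro _ _ ⟨u, v, a, b, hab, rfl, rfl⟩
  simpa using swap u (v ++ p) hab

theorem cons (a : B) {w w' : List B} (h : CommEquiv M w w') :
    CommEquiv M (a :: w) (a :: w') := append_left [a] h

theorem reverse {w w' : List B} (h : CommEquiv M w w') :
    CommEquiv M w.reverse w'.reverse := by
  refine lift (CommEquiv M) equivalence List.reverse ?_ h
  rintro _ _ ⟨u, v, a, b, hab, rfl, rfl⟩
  simpa using symm (swap v.reverse u.reverse hab)

theorem map {φ : B → B} (hφ : ∀ i j, M (φ i) (φ j) = M i j) {w w' : List B}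
    (h : CommEquiv M w w') : CommEquiv M (w.map φ) (w'.map φ) := by
  refine lift (CommEquiv M) equivalence (List.map φ) ?_ h
  rintro _ _ ⟨u, v, a, b, hab, rfl, rfl⟩
  simpa using swap (u.map φ) (v.map φ) ((hφ a b).trans hab)

theorem perm {w w' : List B} (h : CommEquiv M w w') : w.Perm w' := by
  refine lift List.Perm (List.isSetoid B).iseqv id ?_ h
  rintro _ _ ⟨u, v, a, b, hab, rfl, rfl⟩
  exact List.Perm.append_left u (List.Perm.swap _ _ _)

/-- Pairwise commuting letters may be permuted freely. -/
theorem of_perm {l l' : List B} (h : l.Perm l') (hl : l.Pairwise fun a b => M a b = 2) :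
    CommEquiv M l l' := by
  induction h with
  | nil => exact refl _
  | cons x _ ih => exact cons x (ih (List.pairwise_cons.1 hl).2)
  | swap x y l =>
    refine swap [] l ?_
    simpa using (List.pairwise_cons.1 hl).1 x (by simp)
  | trans h₁ _ ih₁ ih₂ =>
    refine trans (ih₁ hl) (ih₂ ((h₁.pairwise_iff ?_).1 hl))
    intro a b hab
    rw [M.symmetric, hab]

/-- A letter commuting with every letter of `l` may be moved across `l`. -/
theorem move (s : B) (l : List B) (hl : ∀ c ∈ l, M s c = 2) :
    CommEquiv M (s :: l) (l ++ [s]) := by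
  induction l with
  | nil => exact refl _
  | cons c l ih =>
    refine trans (swap [] l (hl c (by simp))) ?_
    exact cons c (ih fun d hd => hl d (by simp [hd]))

variable {W : Type*} [Group W] (cs : CoxeterSystem M W)

theorem simple_comm {a b : B} (h : M a b = 2) :
    cs.simple a * cs.simple b = cs.simple b * cs.simple a := by
  have := cs.simple_mul_simple_pow a b
  rw [h, pow_two] at this
  have h2 := eq_inv_of_mul_eq_one_left this
  simpa using h2

theorem wordProd_eq {w w' : List B} (h : CommEquiv M w w') : cs.wordProd w = cs.wordProd w' := by
  refine lift Eq eq_equivalence cs.wordProd ?_ h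
  rintro _ _ ⟨u, v, a, b, hab, rfl, rfl⟩
  simp only [wordProd_append, wordProd_cons, ← mul_assoc]
  rw [mul_assoc _ (cs.simple a), simple_comm cs hab, ← mul_assoc]

end CommEquiv

namespace FullyCommutative

section Coxeter

variable {B : Type*} (M : CoxeterMatrix B)

/-- A Coxeter matrix is simply laced if all its off-diagonal entries are `2` or `3`. -/
def SimplyLaced : Prop := ∀ i j, i ≠ j → M i j = 2 ∨ M i j = 3

variable {M}

variable {W : Type*} [Group W] (cs : CoxeterSystem M W)

theorem simple_braid {a b : B} (h : M a b = 3) :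
    cs.simple a * cs.simple b * cs.simple a = cs.simple b * cs.simple a * cs.simple b := by
  have := cs.simple_mul_simple_pow a b
  rw [h, pow_succ, pow_two] at this
  have h2 := eq_inv_of_mul_eq_one_left
    (show (cs.simple a * cs.simple b * cs.simple a) *
      (cs.simple b * cs.simple a * cs.simple b) = 1 by simpa only [mul_assoc] using this)
  simpa [mul_assoc] using h2

section Exchange

open scoped Classical

/-- The action of a generator on parity functions on the group which accounts for one more letter
at the front of a word. -/
noncomputable def parityStep (i : B) : Function.End (W → ZMod 2) := fun φ t =>
  (if t = cs.simple i then 1 else 0) + φ (cs.simple i * t * cs.simple i)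

theorem conj_eq_iff {G : Type*} [Group G] {a t b : G} (ha : a * a = 1) :
    a * t * a = b ↔ t = a * b * a := by
  constructor
  · rintro rfl
    simp only [← mul_assoc, ha, one_mul]
    simp only [mul_assoc, ha, mul_one]
  · rintro rfl
    simp only [← mul_assoc, ha, one_mul]
    simp only [mul_assoc, ha, mul_one]

theorem parityStep_liftable (hM : SimplyLaced M) : M.IsLiftable (parityStep cs) := by
  intro i j
  have hi := cs.simple_mul_simple_self i
  have hj := cs.simple_mul_simple_self j
  have two : ∀ z : ZMod 2, z + z = 0 := fun z => CharTwo.add_self_eq_zero z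
  rcases eq_or_ne i j with rfl | hij
  · rw [M.diagonal, pow_one]
    funext φ t
    change (if t = cs.simple i then 1 else 0) +
      ((if cs.simple i * t * cs.simple i = cs.simple i then 1 else 0) +
        φ (cs.simple i * (cs.simple i * t * cs.simple i) * cs.simple i)) = φ t
    simp only [conj_eq_iff hi, hi, one_mul, ← add_assoc, two, zero_add]
    congr 1
    simp only [mul_assoc, hi, mul_one, simple_mul_simple_cancel_left]
  rcases hM i j hij with h | h
  · have hc := CommEquiv.simple_comm cs h
    rw [h, pow_two]
    funext φ t
    generalize hA : cs.simple i = a at *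
    generalize hB : cs.simple j = b at *
    change (if t = cs.simple i then 1 else 0) +
      ((if cs.simple i * t * cs.simple i = cs.simple j then 1 else 0) +
      ((if cs.simple j * (cs.simple i * t * cs.simple i) * cs.simple j = cs.simple i then 1 else 0) +
      ((if cs.simple i * (cs.simple j * (cs.simple i * t * cs.simple i) * cs.simple j) *
        cs.simple i = cs.simple j then 1 else 0) +
        φ (cs.simple j * (cs.simple i * (cs.simple j * (cs.simple i * t * cs.simple i) *
          cs.simple j) * cs.simple i) * cs.simple j)))) = φ t
    rw [hA, hB]
    have e1 : a * b * a = b := by rw [hc, mul_assoc, hi, mul_one]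
    have e2 : b * a * b = a := by rw [← hc, mul_assoc, hj, mul_one]
    have e3 : b * (a * (b * (a * t * a) * b) * a) * b = t := by
      have : b * (a * (b * (a * t * a) * b) * a) * b
        = (b * a * b) * a * t * (a * (b * a * b)) := by group
      rw [this, e2, hi, mul_one, one_mul]
    rw [e3]
    simp only [conj_eq_iff hi, conj_eq_iff hj, e1, e2, hi, hj, one_mul]
    linear_combination two (if t = a then 1 else 0) + two (if t = b then 1 else 0)
  · have hc := simple_braid cs h
    rw [h, pow_succ, pow_two]
    funext φ t
    generalize hA : cs.simple i = a at *
    generalize hB : cs.simple j = b at *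
    change (if t = cs.simple i then 1 else 0) +
      ((if cs.simple i * t * cs.simple i = cs.simple j then 1 else 0) +
      ((if cs.simple j * (cs.simple i * t * cs.simple i) * cs.simple j = cs.simple i then 1 else 0) +
      ((if cs.simple i * (cs.simple j * (cs.simple i * t * cs.simple i) * cs.simple j) *
        cs.simple i = cs.simple j then 1 else 0) +
      ((if cs.simple j * (cs.simple i * (cs.simple j * (cs.simple i * t * cs.simple i) *
          cs.simple j) * cs.simple i) * cs.simple j = cs.simple i then 1 else 0) +
      ((if cs.simple i * (cs.simple j * (cs.simple i * (cs.simple j * (cs.simple i * t *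
          cs.simple i) * cs.simple j) * cs.simple i) * cs.simple j) * cs.simple i
          = cs.simple j then 1 else 0) +
        φ (cs.simple j * (cs.simple i * (cs.simple j * (cs.simple i * (cs.simple j *
          (cs.simple i * t * cs.simple i) * cs.simple j) * cs.simple i) * cs.simple j) *
          cs.simple i) * cs.simple j)))))) = φ t
    rw [hA, hB]
    have e1 : a * (b * a * b) * a = b := by
      rw [← hc]; simp only [← mul_assoc, hi, one_mul]; rw [mul_assoc, hi, mul_one]
    have e2 : b * (a * b * a) * b = a := by
      rw [hc]; simp only [← mul_assoc, hj, one_mul]; rw [mul_assoc, hj, mul_one]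
    have e3 : b * (a * (b * (a * (b * (a * t * a) * b) * a) * b) * a) * b = t := by
      have : b * (a * (b * (a * (b * (a * t * a) * b) * a) * b) * a) * b
        = (b * a * b) * (a * b * a) * t * ((a * b * a) * (b * a * b)) := by group
      have h1 : (a * b * a) * (a * b * a) = 1 := by
        have : (a * b * a) * (a * b * a) = a * (b * (a * a) * b) * a := by group
        rw [this, hi, mul_one, hj, mul_one, hi]
      rw [this, ← hc, h1, mul_one, one_mul]
    rw [e3]
    simp only [conj_eq_iff hi, conj_eq_iff hj, e1, e2, hi, hj, one_mul]
    linear_combination two (if t = a then 1 else 0) + two (if t = b then 1 else 0)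
      + two (if t = a * b * a then 1 else 0)

theorem count_leftInvSeq_congr (hM : SimplyLaced M) {u v : List B}
    (h : cs.wordProd u = cs.wordProd v) (t : W) :
    ((cs.leftInvSeq u).count t : ZMod 2) = (cs.leftInvSeq v).count t := by
  have key : ∀ (ω : List B) (t : W),
      ((cs.leftInvSeq ω).count t : ZMod 2) =
        cs.lift ⟨_, parityStep_liftable cs hM⟩ (cs.wordProd ω) 0 t := by
    intro ω
    induction ω with
    | nil => intro t; simp; rfl
    | cons i ω ih =>
      intro t
      have hc : ((cs.leftInvSeq ω).map (MulAut.conj (cs.simple i))).count t =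
          (cs.leftInvSeq ω).count (cs.simple i * t * cs.simple i) := by
        have := List.count_map_of_injective (cs.leftInvSeq ω) (MulAut.conj (cs.simple i))
          (MulEquiv.injective _) (cs.simple i * t * cs.simple i)
        rw [← this]
        congr 1
        simp [mul_assoc]
      rw [leftInvSeq, List.count_cons, hc, wordProd_cons, map_mul, Nat.cast_add, ih,
        lift_apply_simple, add_comm]
      change _ = (if t = cs.simple i then (1 : ZMod 2) else 0) + _
      congr 1
      by_cases ht : t = cs.simple i
      · simp [ht]
      · have : ¬ cs.simple i = t := fun h => ht h.symm
        simp [ht, this]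
  rw [key, key, h]

/-- The exchange property. -/
theorem exchange (hM : SimplyLaced M) {ω : List B} {i : B}
    (h : cs.IsLeftDescent (cs.wordProd ω) i) :
    ∃ j < ω.length, cs.simple i * cs.wordProd ω = cs.wordProd (ω.eraseIdx j) := by
  obtain ⟨ω', hω', hp⟩ := cs.exists_isReduced (cs.simple i * cs.wordProd ω)
  have hlen := cs.isLeftDescent_iff.1 h
  have hprod : cs.wordProd (i :: ω') = cs.wordProd ω := by
    rw [wordProd_cons, ← hp, simple_mul_simple_cancel_left]
  have hred : cs.IsReduced (i :: ω') := by
    unfold CoxeterSystem.IsReduced at *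
    rw [hprod, List.length_cons, ← hω', ← hp, hlen]
  have h1 : (cs.leftInvSeq (i :: ω')).count (cs.simple i) = 1 :=
    List.count_eq_one_of_mem hred.nodup_leftInvSeq (by simp [leftInvSeq])
  have h2 := count_leftInvSeq_congr cs hM hprod (cs.simple i)
  rw [h1] at h2
  have h3 : cs.simple i ∈ cs.leftInvSeq ω := by
    by_contra hn
    rw [List.count_eq_zero_of_not_mem hn] at h2
    simp at h2
  obtain ⟨j, hj, hj'⟩ := List.mem_iff_getElem.1 h3
  refine ⟨j, by simpa using hj, ?_⟩
  rw [← getD_leftInvSeq_mul_wordProd, List.getD_eq_getElem _ 1 hj, hj']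

end Exchange

section Reflection

open scoped Classical

/-- The action of a generator by a reflection on integral weights. -/
noncomputable def reflStep (M : CoxeterMatrix B) (i : B) : Function.End (B → ℤ) := fun μ t =>
  if t = i then - μ i else if M i t = 3 then μ t + μ i else μ t

theorem reflStep_liftable (hM : SimplyLaced M) : M.IsLiftable (reflStep M) := by
  intro i j
  rcases eq_or_ne i j with rfl | hij
  · rw [M.diagonal, pow_one]
    funext μ t
    change reflStep M i (reflStep M i μ) t = μ t
    by_cases h1 : t = i <;> by_cases h2 : M i t = 3 <;> simp [reflStep, h1, h2]
  have hji := hij.symm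
  rcases hM i j hij with h | h
  · have h' : M j i = 2 := by rw [M.symmetric, h]
    rw [h, pow_two]
    funext μ t
    change reflStep M i (reflStep M j (reflStep M i (reflStep M j μ))) t = μ t
    by_cases h1 : t = i
    · simp [reflStep, h1, hij, hji, h, h']
    by_cases h2 : t = j
    · simp [reflStep, h2, hij, hji, h, h']
    by_cases h3 : M i t = 3 <;> by_cases h4 : M j t = 3 <;>
      simp [reflStep, h1, h2, hij, hji, h, h', h3, h4]
    ring
  · have h' : M j i = 3 := by rw [M.symmetric, h]
    rw [h, pow_succ, pow_two]
    funext μ t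
    change reflStep M i (reflStep M j (reflStep M i (reflStep M j
      (reflStep M i (reflStep M j μ))))) t = μ t
    by_cases h1 : t = i
    · simp [reflStep, h1, hij, hji, h, h']
    by_cases h2 : t = j
    · simp [reflStep, h2, hij, hji, h, h']
    by_cases h3 : M i t = 3 <;> by_cases h4 : M j t = 3 <;>
      simp [reflStep, h1, h2, hij, hji, h, h', h3, h4] <;> ring

theorem simple_injective (hM : SimplyLaced M) : Function.Injective cs.simple := by
  intro i j h
  by_contra hij
  have := congrArg (fun w => cs.lift ⟨_, reflStep_liftable hM⟩ w (Pi.single i 1) i) h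
  simp only [lift_apply_simple] at this
  simp [reflStep, hij, Pi.single_apply, Ne.symm hij] at this

theorem not_comm_of_eq_three (hM : SimplyLaced M) {i j : B} (h : M i j = 3) :
    cs.simple i * cs.simple j ≠ cs.simple j * cs.simple i := by
  intro h2
  have hij : i ≠ j := by
    rintro rfl
    simp at h
  have h' : M j i = 3 := by rw [M.symmetric, h]
  have := congrArg (fun w => cs.lift ⟨_, reflStep_liftable hM⟩ w (Pi.single i 1) i) h2
  simp only [lift_apply_simple, map_mul] at this
  change reflStep M i (reflStep M j (Pi.single i 1)) i =
    reflStep M j (reflStep M i (Pi.single i 1)) i at this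
  simp [reflStep, hij, Pi.single_apply, Ne.symm hij, h, h'] at this

end Reflection

end Coxeter

section Game

variable {B : Type*} [DecidableEq B] (M : CoxeterMatrix B)

/-- The state of a word records, for each letter `s`, the number (capped at `2`) of neighbours of
`s` met since the last occurrence of `s`; reading the letter `a` changes it as follows. -/
def fire (x : B → Fin 3) (a : B) : B → Fin 3 := fun t =>
  if t = a then 0 else if M a t = 3 then (if x t = 0 then 1 else 2) else x t

/-- The state reached from `x` after reading a word. -/
def run (x : B → Fin 3) (w : List B) : B → Fin 3 := w.foldl (fire M) x

/-- A word is legal from `x` if every letter is read in a state where its counter is `2`. -/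
def Legal : (B → Fin 3) → List B → Prop
  | _, [] => True
  | x, a :: w => x a = 2 ∧ Legal (fire M x a) w

variable {M}

@[simp] theorem run_nil (x : B → Fin 3) : run M x [] = x := rfl

@[simp] theorem run_cons (x : B → Fin 3) (a : B) (w : List B) :
    run M x (a :: w) = run M (fire M x a) w := rfl

theorem run_append (x : B → Fin 3) (w w' : List B) :
    run M x (w ++ w') = run M (run M x w) w' := List.foldl_append ..

@[simp] theorem legal_nil (x : B → Fin 3) : Legal M x [] := trivial

@[simp] theorem legal_cons (x : B → Fin 3) (a : B) (w : List B) :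
    Legal M x (a :: w) ↔ x a = 2 ∧ Legal M (fire M x a) w := Iff.rfl

theorem legal_append (x : B → Fin 3) (w w' : List B) :
    Legal M x (w ++ w') ↔ Legal M x w ∧ Legal M (run M x w) w' := by
  induction w generalizing x with
  | nil => simp
  | cons a w ih => simp [ih, and_assoc]

theorem fire_self (x : B → Fin 3) (a : B) : fire M x a a = 0 := by simp [fire]

theorem fire_of_comm (x : B → Fin 3) {a t : B} (h : M a t = 2) : fire M x a t = x t := by
  have : t ≠ a := by rintro rfl; simp at h
  simp [fire, this, h]

theorem fire_of_adj (x : B → Fin 3) {a t : B} (h : M a t = 3) :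
    fire M x a t = if x t = 0 then 1 else 2 := by
  have : t ≠ a := by rintro rfl; simp at h
  simp [fire, this, h]

theorem fire_fire_comm (x : B → Fin 3) {a b : B} (h : M a b = 2) :
    fire M (fire M x a) b = fire M (fire M x b) a := by
  have hab : a ≠ b := by rintro rfl; simp at h
  have h' : M b a = 2 := by rw [M.symmetric, h]
  funext t
  by_cases h1 : t = a
  · simp [fire, h1, hab, h']
  by_cases h2 : t = b
  · simp [fire, h2, hab.symm, h]
  by_cases h3 : M a t = 3 <;> by_cases h4 : M b t = 3 <;> simp [fire, h1, h2, h3, h4]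

theorem fire_mono {x x' : B → Fin 3} (h : x ≤ x') (a : B) : fire M x a ≤ fire M x' a := by
  intro t
  have h1 : x t ≤ x' t := h t
  change fire M x a t ≤ fire M x' a t
  unfold fire
  generalize x t = y at *
  generalize x' t = y' at *
  clear h
  split_ifs <;> revert y y' <;> decide

theorem Legal.mono {x x' : B → Fin 3} (h : x ≤ x') {w : List B} (hw : Legal M x w) :
    Legal M x' w := by
  induction w generalizing x x' with
  | nil => trivial
  | cons a w ih =>
    have h1 : x a ≤ x' a := h a
    have h2 := hw.1
    refine ⟨?_, ih (fire_mono h a) hw.2⟩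
    generalize x a = y at *
    generalize x' a = y' at *
    revert y y'
    decide

theorem run_congr (x : B → Fin 3) {w w' : List B} (h : CommEquiv M w w') :
    run M x w = run M x w' := by
  refine CommEquiv.lift Eq eq_equivalence (run M x) ?_ h
  rintro _ _ ⟨u, v, a, b, hab, rfl, rfl⟩
  simp [run_append, fire_fire_comm _ hab]

theorem legal_congr (x : B → Fin 3) {w w' : List B} (h : CommEquiv M w w') :
    Legal M x w ↔ Legal M x w' := by
  refine CommEquiv.lift Iff ⟨Iff.refl, Iff.symm, Iff.trans⟩ (Legal M x) ?_ h
  rintro _ _ ⟨u, v, a, b, hab, rfl, rfl⟩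
  have hba : M b a = 2 := by rw [M.symmetric, hab]
  simp only [legal_append, legal_cons, fire_fire_comm _ hab, fire_of_comm _ hab,
    fire_of_comm _ hba]
  tauto

/-- The state of the empty word. -/
abbrev top : B → Fin 3 := fun _ => 2

theorem le_top (x : B → Fin 3) : x ≤ top := fun t => by
  have := (x t).2
  change x t ≤ 2
  omega

theorem Legal.top_of {x : B → Fin 3} {w : List B} (h : Legal M x w) : Legal M top w :=
  h.mono (le_top x)

theorem Legal.suffix {x : B → Fin 3} {w w' : List B} (h : Legal M x (w ++ w')) :
    Legal M top w' := ((legal_append ..).1 h).2.top_of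

theorem not_legal_square (x : B → Fin 3) (p q : List B) (s : B) :
    ¬ Legal M x (p ++ s :: s :: q) := by
  simp [legal_append, fire_self]

theorem not_legal_braid (x : B → Fin 3) (p q : List B) {s t : B} (h : M s t = 3) :
    ¬ Legal M x (p ++ s :: t :: s :: q) := by
  have h' : M t s = 3 := by rw [M.symmetric, h]
  simp [legal_append, fire_self, fire_of_adj _ h']

theorem exists_square_of_run_eq_zero (hM : SimplyLaced M) (w : List B) (s : B)
    (h : run M top w s = 0) : ∃ p, CommEquiv M w (p ++ [s]) := by
  induction w using List.reverseRecOn with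
  | nil => exact absurd (show (2 : Fin 3) = _ from h) (by decide)
  | append_singleton w c ih =>
    rcases eq_or_ne c s with rfl | hc
    · exact ⟨w, CommEquiv.refl _⟩
    simp only [run_append, run_cons, run_nil] at h
    rcases hM c s hc with h2 | h3
    · rw [fire_of_comm _ h2] at h
      obtain ⟨p, hp⟩ := ih h
      refine ⟨p ++ [c], (hp.append_right [c]).trans ?_⟩
      simpa using CommEquiv.swap p [] (by rw [M.symmetric, h2] : M s c = 2)
    · rw [fire_of_adj _ h3] at h
      split_ifs at h <;> simp at h

theorem exists_braid_of_run_eq_one (hM : SimplyLaced M) (w : List B) (s : B)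
    (h : run M top w s = 1) :
    ∃ p t q, M s t = 3 ∧ (∀ c ∈ q, M s c = 2) ∧ CommEquiv M w (p ++ s :: t :: q) := by
  induction w using List.reverseRecOn with
  | nil => exact absurd (show (2 : Fin 3) = _ from h) (by decide)
  | append_singleton w c ih =>
    simp only [run_append, run_cons, run_nil] at h
    rcases eq_or_ne c s with rfl | hc
    · simp [fire_self] at h
    rcases hM c s hc with h2 | h3
    · rw [fire_of_comm _ h2] at h
      obtain ⟨p, t, q, h1, hq, hp⟩ := ih h
      refine ⟨p, t, q ++ [c], h1, ?_, ?_⟩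
      · intro d hd
        rcases List.mem_append.1 hd with hd | hd
        · exact hq d hd
        · rw [List.mem_singleton.1 hd, M.symmetric, h2]
      · simpa using hp.append_right [c]
    · rw [fire_of_adj _ h3] at h
      split_ifs at h with h0
      · obtain ⟨p, hp⟩ := exists_square_of_run_eq_zero hM w s h0
        refine ⟨p, c, [], by rw [M.symmetric, h3], by simp, ?_⟩
        simpa using hp.append_right [c]
      · simp at h

variable {W : Type*} [Group W] (cs : CoxeterSystem M W)

/-- A reduced word of a fully commutative element is legal. -/
theorem legal_of_isFullyCommutative (hM : SimplyLaced M) {w : W} (hw : IsFullyCommutative cs w)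
    {u : List B} (hu : cs.IsReduced u) (huw : cs.wordProd u = w) : Legal M top u := by
  have key : ∀ v r, u = v ++ r → Legal M top v := by
    intro v
    induction v using List.reverseRecOn with
    | nil => simp
    | append_singleton v s ih =>
      intro r hr
      have hv := ih (s :: r) (by simpa using hr)
      refine (legal_append ..).2 ⟨hv, ?_, trivial⟩
      by_contra hn
      have h01 : run M top v s = 0 ∨ run M top v s = 1 := by omega
      rcases h01 with h0 | h1
      · obtain ⟨p, hp⟩ := exists_square_of_run_eq_zero hM v s h0
        have h3 : CommEquiv M u (p ++ s :: s :: r) := by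
          rw [hr]; simpa using hp.append_right (s :: r)
        have h4 : cs.wordProd u = cs.wordProd (p ++ r) := by
          rw [h3.wordProd_eq cs]
          simp [wordProd_append, wordProd_cons]
        have h5 := cs.length_wordProd_le (p ++ r)
        rw [← h4, hu, h3.perm.length_eq] at h5
        simp at h5
      · obtain ⟨p, t, q, hst, hq, hp⟩ := exists_braid_of_run_eq_one hM v s h1
        have h3 : CommEquiv M u (p ++ s :: t :: s :: (q ++ r)) := by
          rw [hr, List.append_assoc]
          refine (hp.append_right ([s] ++ r)).trans ?_
          have := ((CommEquiv.move s q hq).symm.append_left (p ++ [s, t])).append_right r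
          simpa using this
        have h4 : cs.wordProd (p ++ t :: s :: t :: (q ++ r)) = cs.wordProd u := by
          rw [h3.wordProd_eq cs]
          have := congrArg (fun g => cs.wordProd p * g * (cs.wordProd q * cs.wordProd r))
            (simple_braid cs hst)
          simpa only [wordProd_append, wordProd_cons, mul_assoc] using this.symm
        have h5 := hw u (p ++ t :: s :: t :: (q ++ r)) hu huw (by
          rw [CoxeterSystem.IsReduced, h4, hu, h3.perm.length_eq]; simp) (h4.trans huw)
        have h6 := (h3.symm.trans h5).perm.count_eq s
        have hne : t ≠ s := by rintro rfl; simp at hst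
        simp [List.count_cons, hne] at h6
  exact key u [] (by simp)

theorem legal_reduced_unique (hM : SimplyLaced M) (k : ℕ) : ∀ u : List B, u.length = k →
    Legal M top u → cs.IsReduced u ∧
      ∀ v, cs.IsReduced v → cs.wordProd v = cs.wordProd u → CommEquiv M u v := by
  induction k using Nat.strong_induction_on with
  | _ k ih =>
  intro u huk hu
  match u, huk, hu with
  | [], _, _ =>
    refine ⟨by simp [CoxeterSystem.IsReduced], fun v hv hvu => ?_⟩
    have : v = [] := by
      rw [← List.length_eq_zero_iff, ← hv, hvu]; simp
    rw [this]; exact CommEquiv.refl _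
  | s :: u', huk, hu =>
    simp only [List.length_cons] at huk
    have hu' : Legal M top u' := Legal.suffix (w := [s]) hu
    obtain ⟨hr', huniq'⟩ := ih u'.length (by omega) u' rfl hu'
    have hred : cs.IsReduced (s :: u') := by
      rcases cs.length_simple_mul (cs.wordProd u') s with h | h
      · rw [CoxeterSystem.IsReduced, wordProd_cons, h, hr', List.length_cons]
      · exfalso
        obtain ⟨z, hz, hzp⟩ := cs.exists_isReduced (cs.simple s * cs.wordProd u')
        have hz2 : cs.wordProd (s :: z) = cs.wordProd u' := by
          rw [wordProd_cons, ← hzp, simple_mul_simple_cancel_left]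
        have hz3 : cs.IsReduced (s :: z) := by
          rw [CoxeterSystem.IsReduced, hz2, List.length_cons, ← hz, ← hzp, h]
        have := (huniq' _ hz3 hz2).cons s
        exact not_legal_square top [] z s ((legal_congr _ this).1 hu)
    refine ⟨hred, fun v hv hvu => ?_⟩
    have hvlen : v.length = u'.length + 1 := by rw [← hv, hvu, hred]; rfl
    match v, hvlen, hv, hvu with
    | t :: v', hvlen, hv, hvu =>
    have hv' : cs.IsReduced v' := by simpa using hv.drop 1
    rcases eq_or_ne s t with rfl | hst
    · refine (huniq' v' hv' ?_).cons s
      simpa [wordProd_cons] using hvu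
    have hvu' : cs.wordProd v' = cs.simple t * cs.wordProd (s :: u') := by
      rw [← hvu, wordProd_cons, simple_mul_simple_cancel_left]
    have hdt : cs.IsLeftDescent (cs.wordProd (s :: u')) t := by
      rw [IsLeftDescent, ← hvu', hv', hred]
      simp only [List.length_cons] at *
      omega
    obtain ⟨j, hj, hjp⟩ := exchange cs hM hdt
    rcases j with _ | j
    · exfalso
      simp only [List.eraseIdx_cons_zero, wordProd_cons] at hjp
      have h1 : cs.simple t * cs.simple s = 1 := by
        have := congrArg (· * (cs.wordProd u')⁻¹) hjp
        simpa [mul_assoc] using this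
      have h2 := eq_inv_of_mul_eq_one_left h1
      rw [inv_simple] at h2
      exact hst (simple_injective cs hM h2.symm)
    simp only [List.length_cons, add_lt_add_iff_right] at hj
    simp only [List.eraseIdx_cons_succ] at hjp
    generalize hu2 : u'.eraseIdx j = u2 at hjp
    have hlen2 : u2.length + 1 = u'.length := by rw [← hu2, List.length_eraseIdx_add_one hj]
    have hw2 : cs.wordProd (t :: s :: u2) = cs.wordProd (s :: u') := by
      rw [wordProd_cons, ← hjp, simple_mul_simple_cancel_left]
    have hu'w : cs.wordProd u' = cs.simple s * cs.wordProd (t :: s :: u2) := by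
      rw [hw2, wordProd_cons, simple_mul_simple_cancel_left]
    rcases hM s t hst with h2 | h3
    · have e1 : cs.wordProd (t :: u2) = cs.wordProd u' := by
        rw [hu'w]
        simp only [wordProd_cons]
        rw [← mul_assoc (cs.simple t), ← CommEquiv.simple_comm cs h2, mul_assoc,
          simple_mul_simple_cancel_left]
      have e2 : cs.IsReduced (t :: u2) := by
        rw [CoxeterSystem.IsReduced, e1, hr', List.length_cons, hlen2]
      have e3 := ((huniq' _ e2 e1).cons s).trans (CommEquiv.swap [] u2 h2)
      refine e3.trans (CommEquiv.cons t ?_)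
      have e4 := Legal.suffix (w := [t]) ((legal_congr _ e3).1 hu)
      refine (ih (s :: u2).length (by simp; omega) _ rfl e4).2 v' hv' ?_
      rw [hvu', ← hw2, wordProd_cons _ t, simple_mul_simple_cancel_left]
    · exfalso
      have hds : cs.IsLeftDescent (cs.wordProd (t :: s :: u2)) s := by
        rw [IsLeftDescent, ← hu'w, hw2, hred, hr']
        simp
      obtain ⟨i, hi, hip⟩ := exchange cs hM hds
      rcases i with _ | _ | i
      · simp only [List.eraseIdx_cons_zero, wordProd_cons] at hip
        have h1 := mul_left_cancel hip
        have h4 := cs.length_wordProd_le u2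
        rw [← h1, ← wordProd_cons, ← wordProd_cons, hw2, hred] at h4
        simp at h4
        omega
      · simp only [List.eraseIdx_cons_zero, List.eraseIdx_cons_succ, wordProd_cons] at hip
        refine not_comm_of_eq_three cs hM h3 ?_
        have h5 : cs.simple s * (cs.simple t * cs.simple s) = cs.simple t := by
          have := congrArg (· * (cs.wordProd u2)⁻¹) hip
          simpa [mul_assoc] using this
        have h6 := congrArg (cs.simple s * ·) h5
        simp only [simple_mul_simple_cancel_left] at h6
        exact h6.symm
      · simp only [List.eraseIdx_cons_succ] at hip
        generalize hu3 : u2.eraseIdx i = u3 at hip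
        simp only [List.length_cons, add_lt_add_iff_right] at hi
        have hlen3 : u3.length + 1 = u2.length := by rw [← hu3, List.length_eraseIdx_add_one hi]
        rw [← hu'w] at hip
        have e2 : cs.IsReduced (t :: s :: u3) := by
          rw [CoxeterSystem.IsReduced, ← hip, hr']
          simp; omega
        have e3 := (huniq' _ e2 hip.symm).cons s
        exact not_legal_braid top [] u3 h3 ((legal_congr _ e3).1 hu)

theorem Legal.isReduced (hM : SimplyLaced M) {u : List B} (hu : Legal M top u) :
    cs.IsReduced u := (legal_reduced_unique cs hM _ u rfl hu).1

theorem Legal.commEquiv (hM : SimplyLaced M) {u v : List B} (hu : Legal M top u)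
    (hv : cs.IsReduced v) (h : cs.wordProd v = cs.wordProd u) : CommEquiv M u v :=
  (legal_reduced_unique cs hM _ u rfl hu).2 v hv h

theorem Legal.isFullyCommutative (hM : SimplyLaced M) {u : List B} (hu : Legal M top u) :
    IsFullyCommutative cs (cs.wordProd u) := fun _ _ h₁ h₁' h₂ h₂' =>
  (hu.commEquiv cs hM h₁ h₁').symm.trans (hu.commEquiv cs hM h₂ h₂')

end Game

section Trace

variable {B : Type*} (M : CoxeterMatrix B)

/-- The letter `a` is a possible first letter of a word up to commutation. -/
def CanStart (a : B) : List B → Prop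
  | [] => False
  | c :: y => c = a ∨ (M a c = 2 ∧ CanStart a y)

/-- Commutation classes of words. -/
def Trace : Type _ := Quot (CommMove M)

variable {M}

/-- The commutation class of a word. -/
def Trace.mk (y : List B) : Trace M := Quot.mk _ y

theorem Trace.mk_eq_mk {y y' : List B} :
    (Trace.mk y : Trace M) = Trace.mk y' ↔ CommEquiv M y y' := Quot.eq

theorem canStart_congr (a : B) {y y' : List B} (h : CommEquiv M y y') :
    CanStart M a y ↔ CanStart M a y' := by
  refine CommEquiv.lift Iff ⟨Iff.refl, Iff.symm, Iff.trans⟩ (CanStart M a) ?_ h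
  rintro _ _ ⟨u, v, b, c, hbc, rfl, rfl⟩
  have hcb : M c b = 2 := by rw [M.symmetric, hbc]
  induction u with
  | nil =>
    simp only [List.nil_append, CanStart]
    constructor
    · rintro (rfl | ⟨h1, rfl | h2⟩)
      · exact .inr ⟨hbc, .inl rfl⟩
      · exact .inl rfl
      · exact .inr ⟨h2.1, .inr ⟨h1, h2.2⟩⟩
    · rintro (rfl | ⟨h1, rfl | h2⟩)
      · exact .inr ⟨hcb, .inl rfl⟩
      · exact .inl rfl
      · exact .inr ⟨h2.1, .inr ⟨h1, h2.2⟩⟩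
  | cons d u ih =>
    simp only [List.cons_append, CanStart, ih]

theorem CanStart.exists_commEquiv {a : B} {y : List B} (h : CanStart M a y) :
    ∃ y', CommEquiv M y (a :: y') := by
  induction y with
  | nil => exact h.elim
  | cons c y ih =>
    rcases h with rfl | ⟨h1, h2⟩
    · exact ⟨y, .refl _⟩
    · obtain ⟨y', hy'⟩ := ih h2
      refine ⟨c :: y', (hy'.cons c).trans (CommEquiv.swap [] y' ?_)⟩
      rw [M.symmetric, h1]

theorem exists_commEquiv_append {bs : List B} (hbs : bs.Nodup) {y : List B}
    (h : ∀ b ∈ bs, CanStart M b y) :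
    bs.Pairwise (fun a b => M a b = 2) ∧ ∃ y', CommEquiv M y (bs ++ y') := by
  induction bs generalizing y with
  | nil => exact ⟨.nil, y, .refl _⟩
  | cons b bs ih =>
    obtain ⟨y₁, h₁⟩ := (h b (by simp)).exists_commEquiv
    obtain ⟨hb, hbs⟩ := List.nodup_cons.1 hbs
    have key : ∀ c ∈ bs, M c b = 2 ∧ CanStart M c y₁ := by
      intro c hc
      rcases (canStart_congr c h₁).1 (h c (by simp [hc])) with rfl | h2
      · exact absurd hc hb
      · exact h2
    obtain ⟨h2, y', hy'⟩ := ih hbs fun c hc => (key c hc).2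
    refine ⟨List.pairwise_cons.2 ⟨fun c hc => ?_, h2⟩, y', h₁.trans (hy'.cons b)⟩
    rw [M.symmetric, (key c hc).1]

theorem canStart_append {bs : List B} (h : bs.Pairwise fun a b => M a b = 2) (y : List B)
    {b : B} (hb : b ∈ bs) : CanStart M b (bs ++ y) := by
  induction bs with
  | nil => simp at hb
  | cons c bs ih =>
    obtain ⟨h1, h2⟩ := List.pairwise_cons.1 h
    rcases List.mem_cons.1 hb with rfl | hb
    · exact .inl rfl
    · exact .inr ⟨by rw [M.symmetric, h1 b hb], ih h2 hb⟩

variable (M) in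
/-- Prepending a fixed word to a commutation class. -/
def Trace.prepend (bs : List B) : Trace M → Trace M :=
  Quot.map (bs ++ ·) fun _ _ ⟨u, v, a, b, h, h1, h2⟩ =>
    ⟨bs ++ u, v, a, b, h, by simp [h1], by simp [h2]⟩

theorem Trace.prepend_mk (bs y : List B) :
    Trace.prepend M bs (Trace.mk y) = Trace.mk (bs ++ y) := rfl

section DecEq

variable [DecidableEq B]

theorem legal_of_pairwise {bs : List B} (h : bs.Pairwise fun a b => M a b = 2)
    {x : B → Fin 3} (hx : ∀ b ∈ bs, x b = 2) : Legal M x bs := by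
  induction bs generalizing x with
  | nil => trivial
  | cons b bs ih =>
    obtain ⟨h3, h4⟩ := List.pairwise_cons.1 h
    refine ⟨hx b (by simp), ih h4 fun c hc => ?_⟩
    rw [fire_of_comm _ (h3 c hc), hx c (by simp [hc])]

theorem CommEquiv.erase (a : B) {y y' : List B} (h : CommEquiv M y y') :
    CommEquiv M (y.erase a) (y'.erase a) := by
  refine CommEquiv.lift (CommEquiv M) CommEquiv.equivalence (fun w => w.erase a) ?_ h
  rintro _ _ ⟨u, v, b, c, hbc, rfl, rfl⟩
  have hne : b ≠ c := by rintro rfl; simp at hbc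
  by_cases ha : a ∈ u
  · simp only [List.erase_append_left _ ha]
    exact CommEquiv.swap _ _ hbc
  · simp only [List.erase_append_right _ ha]
    refine CommEquiv.append_left u ?_
    by_cases hb : b = a
    · subst hb
      simp [List.erase_cons, hne.symm]
      exact .refl _
    by_cases hc : c = a
    · subst hc
      simp [List.erase_cons, hne]
      exact .refl _
    · simp [List.erase_cons, hb, hc]
      exact CommEquiv.swap [] _ hbc

theorem CommEquiv.cancel_cons {a : B} {y y' : List B} (h : CommEquiv M (a :: y) (a :: y')) :
    CommEquiv M y y' := by
  simpa using CommEquiv.erase a h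

theorem CommEquiv.cancel_append (bs : List B) {y y' : List B}
    (h : CommEquiv M (bs ++ y) (bs ++ y')) : CommEquiv M y y' := by
  induction bs with
  | nil => exact h
  | cons b bs ih => exact ih (CommEquiv.cancel_cons h)

theorem Trace.prepend_injective (bs : List B) : Function.Injective (Trace.prepend M bs) := by
  rintro ⟨y⟩ ⟨y'⟩ h
  exact Trace.mk_eq_mk.2 (CommEquiv.cancel_append bs (Trace.mk_eq_mk.1 h))

variable [Finite B]

theorem finite_legal_traces (x : B → Fin 3) (ℓ : ℕ) :
    {q : Trace M | ∃ y, Trace.mk y = q ∧ Legal M x y ∧ y.length = ℓ}.Finite := by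
  refine ((List.finite_length_eq B ℓ).image Trace.mk).subset ?_
  rintro _ ⟨y, rfl, -, h⟩
  exact ⟨y, h, rfl⟩

variable (M) in
/-- The commutation classes of legal words of length `ℓ` from the state `x`. -/
noncomputable def legalTraces (x : B → Fin 3) (ℓ : ℕ) : Finset (Trace M) :=
  (finite_legal_traces (M := M) x ℓ).toFinset

theorem mem_legalTraces {x : B → Fin 3} {ℓ : ℕ} {q : Trace M} :
    q ∈ legalTraces M x ℓ ↔ ∃ y, Trace.mk y = q ∧ Legal M x y ∧ y.length = ℓ := by
  simp [legalTraces]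

theorem mk_mem_legalTraces {x : B → Fin 3} {ℓ : ℕ} {y : List B} :
    Trace.mk y ∈ legalTraces M x ℓ ↔ Legal M x y ∧ y.length = ℓ := by
  rw [mem_legalTraces]
  constructor
  · rintro ⟨y', h1, h2⟩
    rw [Trace.mk_eq_mk] at h1
    rwa [← legal_congr x h1, ← h1.perm.length_eq]
  · exact fun h => ⟨y, rfl, h⟩

open scoped Classical in
/-- The legal classes which may start with any letter of `bs`. -/
noncomputable def startingWith (x : B → Fin 3) (ℓ : ℕ) (bs : List B) : Finset (Trace M) :=
  {q ∈ legalTraces M x ℓ | ∀ b ∈ bs, ∃ y, q = Trace.mk y ∧ CanStart M b y}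

open scoped Classical in
theorem mem_startingWith {x : B → Fin 3} {ℓ : ℕ} {bs : List B} {q : Trace M} :
    q ∈ startingWith x ℓ bs ↔
      q ∈ legalTraces M x ℓ ∧ ∀ b ∈ bs, ∃ y, q = Trace.mk y ∧ CanStart M b y :=
  Finset.mem_filter

theorem card_startingWith (x : B → Fin 3) (bs : List B) (hbs : bs.Nodup)
    (hc : bs.Pairwise fun a b => M a b = 2) (hx : ∀ b ∈ bs, x b = 2) (ℓ : ℕ) :
    (startingWith (M := M) x (ℓ + bs.length) bs).card =
      (legalTraces M (run M x bs) ℓ).card := by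
  classical
  rw [← Finset.card_image_of_injective (legalTraces M (run M x bs) ℓ) (Trace.prepend_injective (M := M) bs)]
  congr 1
  ext q
  obtain ⟨w, rfl⟩ : ∃ w, q = Trace.mk w := ⟨_, (Quot.out_eq q).symm⟩
  simp only [mem_startingWith, Finset.mem_image]
  constructor
  · rintro ⟨h1, h2⟩
    have h3 : ∀ b ∈ bs, CanStart M b w := by
      intro b hb
      obtain ⟨y, hy, hy'⟩ := h2 b hb
      exact (canStart_congr b (Trace.mk_eq_mk.1 hy)).2 hy'
    obtain ⟨-, y', hy'⟩ := exists_commEquiv_append hbs h3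
    rw [Trace.mk_eq_mk.2 hy', mk_mem_legalTraces, legal_append] at h1
    refine ⟨Trace.mk y', mk_mem_legalTraces.2 ⟨h1.1.2, ?_⟩, (Trace.mk_eq_mk.2 hy').symm⟩
    have := h1.2
    simp at this
    omega
  · rintro ⟨q, h1, h2⟩
    obtain ⟨y, rfl⟩ : ∃ y, q = Trace.mk y := ⟨_, (Quot.out_eq q).symm⟩
    rw [← h2, Trace.prepend_mk, mk_mem_legalTraces, legal_append]
    rw [mk_mem_legalTraces] at h1
    refine ⟨⟨⟨legal_of_pairwise hc hx, h1.1⟩, by simp; omega⟩, fun b hb => ⟨_, rfl, canStart_append hc y hb⟩⟩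

variable (M) in
/-- The number of legal classes from `x` is ultimately periodic, with period dividing `m`. -/
def UltPeriodic (m : ℕ) (x : B → Fin 3) : Prop :=
  ∃ N, ∀ ℓ, N ≤ ℓ → (legalTraces M x (ℓ + m)).card = (legalTraces M x ℓ).card

theorem ultPeriodic_of_forall (m : ℕ) (x : B → Fin 3)
    (h : ∀ bs : List B, bs ≠ [] → (bs.Pairwise fun a b => M a b = 2) → (∀ b ∈ bs, x b = 2) →
      UltPeriodic M m (run M x bs)) : UltPeriodic M m x := by
  classical
  have := Fintype.ofFinite B
  let S : ℕ → B → Finset (Trace M) := fun ℓ b =>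
    {q ∈ legalTraces M x ℓ | ∃ y, q = Trace.mk y ∧ CanStart M b y}
  have hS : ∀ ℓ, 1 ≤ ℓ → legalTraces M x ℓ = Finset.univ.biUnion (S ℓ) := by
    intro ℓ hℓ
    ext q
    simp only [S, Finset.mem_biUnion, Finset.mem_univ, true_and, Finset.mem_filter]
    constructor
    · intro hq
      obtain ⟨y, rfl, h1, h2⟩ := mem_legalTraces.1 hq
      cases y with
      | nil => simp at h2; omega
      | cons b y => exact ⟨b, hq, _, rfl, .inl rfl⟩
    · rintro ⟨b, h, -⟩
      exact h
  have key : ∀ T : Finset B, ∃ N, ∀ hT : T.Nonempty, ∀ ℓ, N ≤ ℓ →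
      (T.inf' hT (S (ℓ + m))).card = (T.inf' hT (S ℓ)).card := by
    intro T
    have hinf : ∀ (hT : T.Nonempty) ℓ, T.inf' hT (S ℓ) = startingWith x ℓ T.toList := by
      intro hT ℓ
      ext q
      rw [Finset.mem_inf', mem_startingWith]
      obtain ⟨t, ht⟩ := hT
      simp only [S, Finset.mem_filter, Finset.mem_toList]
      exact ⟨fun h => ⟨(h t ht).1, fun b hb => (h b hb).2⟩, fun h b hb => ⟨h.1, h.2 b hb⟩⟩
    by_cases hT : T.Nonempty
    swap
    · exact ⟨0, fun h => absurd h hT⟩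
    by_cases hc : (T.toList.Pairwise fun a b => M a b = 2) ∧ ∀ b ∈ T.toList, x b = 2
    · obtain ⟨N, hN⟩ := h T.toList (by simpa using hT.ne_empty) hc.1 hc.2
      refine ⟨N + T.toList.length, fun _ ℓ hℓ => ?_⟩
      obtain ⟨k, rfl⟩ := Nat.exists_eq_add_of_le hℓ
      have e1 := card_startingWith x T.toList T.nodup_toList hc.1 hc.2 (N + k)
      have e2 := card_startingWith x T.toList T.nodup_toList hc.1 hc.2 (N + k + m)
      rw [hinf, hinf, show N + T.toList.length + k + m = N + k + m + T.toList.length by ring,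
        show N + T.toList.length + k = N + k + T.toList.length by ring, e1, e2, hN _ (by omega)]
    · have : ∀ ℓ, T.inf' hT (S ℓ) = ∅ := by
        intro ℓ
        rw [hinf, Finset.eq_empty_iff_forall_notMem]
        intro q hq
        obtain ⟨h1, h2⟩ := mem_startingWith.1 hq
        obtain ⟨w, rfl⟩ : ∃ w, q = Trace.mk w := ⟨_, (Quot.out_eq q).symm⟩
        have h3 : ∀ b ∈ T.toList, CanStart M b w := by
          intro b hb
          obtain ⟨y, hy, hy'⟩ := h2 b hb
          exact (canStart_congr b (Trace.mk_eq_mk.1 hy)).2 hy'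
        refine hc ⟨(exists_commEquiv_append T.nodup_toList h3).1, fun b hb => ?_⟩
        obtain ⟨y, hy⟩ := (h3 b hb).exists_commEquiv
        exact ((legal_congr x hy).1 (mk_mem_legalTraces.1 h1).1).1
      exact ⟨0, fun _ ℓ _ => by rw [this, this]⟩
  choose N hN using key
  refine ⟨1 + ∑ T, N T, fun ℓ hℓ => ?_⟩
  have := Finset.inclusion_exclusion_card_biUnion Finset.univ (S ℓ)
  have h2 := Finset.inclusion_exclusion_card_biUnion Finset.univ (S (ℓ + m))
  rw [hS ℓ (by omega), hS (ℓ + m) (by omega)]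
  zify
  rw [this, h2]
  refine Finset.sum_congr rfl fun T _ => ?_
  rw [hN]
  have := Finset.single_le_sum (f := N) (fun _ _ => Nat.zero_le _) (Finset.mem_univ T.1)
  omega

end DecEq

end Trace

section Recurrence

variable {B : Type*} [DecidableEq B] (M : CoxeterMatrix B)

/-- A state to which one may return. -/
def Recurrent (x : B → Fin 3) : Prop := ∃ y, y ≠ [] ∧ Legal M x y ∧ run M x y = x

variable {M}

theorem ultPeriodic_of_recurrent [Finite B] {m : ℕ}
    (h : ∀ x, Recurrent M x → UltPeriodic M m x) (x : B → Fin 3) : UltPeriodic M m x := by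
  let r : (B → Fin 3) → (B → Fin 3) → Prop := fun x' x =>
    ¬ Recurrent M x ∧ ∃ y, y ≠ [] ∧ Legal M x y ∧ run M x y = x'
  have : IsTrans _ r := ⟨by
    rintro x y z ⟨-, p, hp, hp', rfl⟩ ⟨hz, q, hq, hq', rfl⟩
    exact ⟨hz, q ++ p, by simp [hp], (legal_append ..).2 ⟨hq', hp'⟩, run_append ..⟩⟩
  have : Std.Irrefl r := ⟨fun x hx => hx.1 hx.2⟩
  have hwf : WellFounded r := Finite.wellFounded_of_trans_of_irrefl r
  induction x using hwf.induction with
  | _ x ih =>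
  by_cases hx : Recurrent M x
  · exact h x hx
  refine ultPeriodic_of_forall m x fun bs hbs hc hb => ih _ ⟨hx, bs, hbs, ?_, rfl⟩
  exact legal_of_pairwise hc hb

variable (M) in
/-- The Cartan matrix of a simply laced Coxeter matrix. -/
def cartan (a b : B) : ℤ := if b = a then 2 else if M a b = 3 then -1 else 0

theorem cartan_comm (a b : B) : cartan M a b = cartan M b a := by
  unfold cartan
  rw [M.symmetric a b]
  simp only [eq_comm]

theorem cartan_self (a : B) : cartan M a a = 2 := by simp [cartan]

variable (M) in
/-- The letter `a` can be fired from `x` without capping any counter. -/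
def TightAt (x : B → Fin 3) (a : B) : Prop := x a = 2 ∧ ∀ t, M a t = 3 → x t ≠ 2

variable (M) in
/-- No counter gets capped when reading the word from `x`. -/
def Tight : (B → Fin 3) → List B → Prop
  | _, [] => True
  | x, a :: w => TightAt M x a ∧ Tight (fire M x a) w

theorem fire_le (x : B → Fin 3) {a : B} (hx : x a = 2) (t : B) :
    ((fire M x a t : ℕ) : ℤ) ≤ (x t : ℕ) - cartan M a t := by
  unfold fire cartan
  split_ifs with h1 h2 h3
  · subst h1; simp [hx]
  · simp [h3]
  · have : (x t : ℕ) ≠ 0 := fun h => h3 (Fin.ext h)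
    simp; omega
  · simp

theorem TightAt.fire_eq {x : B → Fin 3} {a : B} (hx : TightAt M x a) (t : B) :
    ((fire M x a t : ℕ) : ℤ) = (x t : ℕ) - cartan M a t := by
  unfold fire cartan
  split_ifs with h1 h2 h3
  · subst h1; simp [hx.1]
  · simp [h3]
  · have h5 : (x t : ℕ) ≠ 0 := fun h => h3 (Fin.ext h)
    have h4 : (x t : ℕ) ≠ 2 := fun h => hx.2 t h2 (Fin.ext h)
    have := (x t).2
    simp; omega
  · simp

theorem Tight.run_eq {x : B → Fin 3} {w : List B} (h : Tight M x w) (t : B) :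
    ((run M x w t : ℕ) : ℤ) = (x t : ℕ) - (w.map fun a => cartan M a t).sum := by
  induction w generalizing x with
  | nil => simp
  | cons a w ih =>
    rw [run_cons, ih h.2, h.1.fire_eq, List.map_cons, List.sum_cons]
    ring

theorem Tight.energy {x : B → Fin 3} {w : List B} (h : Tight M x w) :
    (w.map fun a => (w.map fun b => cartan M b a).sum).sum =
      2 * (w.map fun a => ((x a : ℕ) : ℤ) - 1).sum := by
  induction w generalizing x with
  | nil => simp
  | cons a w ih =>
    have e1 := ih h.2
    have e2 : (w.map fun s => ((fire M x a s : ℕ) : ℤ) - 1).sum =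
        (w.map fun s => ((x s : ℕ) : ℤ) - 1).sum - (w.map fun b => cartan M b a).sum := by
      have : ∀ s, ((fire M x a s : ℕ) : ℤ) - 1 + cartan M s a = ((x s : ℕ) : ℤ) - 1 := by
        intro s
        rw [h.1.fire_eq, cartan_comm]
        ring
      simp only [← this, List.sum_map_add]
      ring
    have e3 : (w.map fun b => cartan M a b) = w.map fun b => cartan M b a := by
      simp only [cartan_comm a]
    simp only [List.map_cons, List.sum_cons, List.sum_map_add, e1, e2, e3, cartan_self, h.1.1]
    simp
    ring

theorem Tight.canStart (hM : SimplyLaced M) {x : B → Fin 3} {w : List B} (h : Tight M x w)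
    {a : B} (hx : x a = 2) (ha : a ∈ w) : CanStart M a w := by
  induction w generalizing x with
  | nil => simp at ha
  | cons c w ih =>
    rcases eq_or_ne c a with rfl | hc
    · exact .inl rfl
    rcases hM c a hc with h2 | h3
    · refine .inr ⟨by rw [M.symmetric, h2], ih h.2 ?_ ?_⟩
      · rw [fire_of_comm _ h2, hx]
      · exact (List.mem_cons.1 ha).resolve_left hc.symm
    · exact absurd hx (h.1.2 a h3)

variable [Fintype B]

variable (M) in
/-- The weight `δ` is a positive generator of the kernel of the Cartan matrix. -/
structure IsNullRoot (δ : B → ℤ) : Prop where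
  pos : ∀ a, 0 < δ a
  sum_eq_zero : ∀ a, ∑ t, cartan M a t * δ t = 0
  exists_eq : ∀ c : B → ℤ, (∀ a, ∑ t, cartan M a t * c t = 0) → ∃ k, ∀ t, c t = k * δ t

/-- The total weight of a state. -/
def weight (δ : B → ℤ) (x : B → Fin 3) : ℤ := ∑ t, ((x t : ℕ) : ℤ) * δ t

variable {δ : B → ℤ} (hδ : IsNullRoot M δ)
include hδ

theorem weight_fire_le {x : B → Fin 3} {a : B} (hx : x a = 2) :
    weight δ (fire M x a) ≤ weight δ x := by
  have : weight δ x = ∑ t, (((x t : ℕ) : ℤ) - cartan M a t) * δ t := by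
    simp only [sub_mul, Finset.sum_sub_distrib, hδ.sum_eq_zero, sub_zero]; rfl
  rw [this]
  exact Finset.sum_le_sum fun t _ => mul_le_mul_of_nonneg_right (fire_le x hx t) (hδ.pos t).le

theorem tightAt_of_weight_eq {x : B → Fin 3} {a : B} (hx : x a = 2)
    (h : weight δ (fire M x a) = weight δ x) : TightAt M x a := by
  refine ⟨hx, fun t ht h2 => h.not_lt ?_⟩
  have : weight δ x = ∑ t, (((x t : ℕ) : ℤ) - cartan M a t) * δ t := by
    simp only [sub_mul, Finset.sum_sub_distrib, hδ.sum_eq_zero, sub_zero]; rfl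
  rw [this]
  refine Finset.sum_lt_sum (fun t _ => mul_le_mul_of_nonneg_right (fire_le x hx t) (hδ.pos t).le)
    ⟨t, Finset.mem_univ t, mul_lt_mul_of_pos_right ?_ (hδ.pos t)⟩
  have hta : t ≠ a := by rintro rfl; simp at ht
  simp [fire, cartan, ht, h2, hta]

theorem Legal.weight_run_le {x : B → Fin 3} {w : List B} (h : Legal M x w) :
    weight δ (run M x w) ≤ weight δ x := by
  induction w generalizing x with
  | nil => rfl
  | cons a w ih => exact (ih h.2).trans (weight_fire_le hδ h.1)

theorem Legal.tight {x : B → Fin 3} {w : List B} (h : Legal M x w)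
    (hw : weight δ (run M x w) = weight δ x) : Tight M x w := by
  induction w generalizing x with
  | nil => trivial
  | cons a w ih =>
    have h1 := weight_fire_le hδ h.1
    have h2 := h.2.weight_run_le hδ
    rw [run_cons] at hw
    exact ⟨tightAt_of_weight_eq hδ h.1 (by omega), ih h.2 (by omega)⟩

/-- The content of a cycle. -/
theorem exists_count_eq {x : B → Fin 3} {y : List B} (hy : y ≠ []) (h : Legal M x y)
    (hx : run M x y = x) : ∃ k : ℤ, 0 < k ∧ ∀ t, (y.count t : ℤ) = k * δ t := by
  have ht := h.tight hδ (by rw [hx])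
  obtain ⟨k, hk⟩ := hδ.exists_eq (fun t => (y.count t : ℤ)) fun a => by
    have := ht.run_eq a
    rw [hx] at this
    have h2 : (y.map fun b => cartan M b a).sum = 0 := by omega
    rw [Finset.sum_list_map_count] at h2
    rw [← h2]
    refine (Finset.sum_subset (Finset.subset_univ y.toFinset) ?_).symm.trans ?_
    · intro t _ ht
      rw [List.mem_toFinset] at ht
      simp [List.count_eq_zero_of_not_mem ht]
    · refine Finset.sum_congr rfl fun t _ => ?_
      rw [cartan_comm, nsmul_eq_mul, mul_comm]
  refine ⟨k, ?_, hk⟩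
  obtain ⟨a, ha⟩ := List.exists_mem_of_ne_nil y hy
  have h1 : (0 : ℤ) < y.count a := by exact_mod_cast List.count_pos_iff.2 ha
  rw [hk] at h1
  exact pos_of_mul_pos_left h1 (hδ.pos a).le

theorem mem_of_cycle {x : B → Fin 3} {y : List B} (hy : y ≠ []) (h : Legal M x y)
    (hx : run M x y = x) (a : B) : a ∈ y := by
  obtain ⟨k, hk, hk'⟩ := exists_count_eq hδ hy h hx
  rw [← List.count_pos_iff]
  have := mul_pos hk (hδ.pos a)
  rw [← hk' a] at this
  exact_mod_cast this

theorem Recurrent.tightAt_and_fire (hM : SimplyLaced M) {x : B → Fin 3} (hx : Recurrent M x)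
    {a : B} (ha : x a = 2) : TightAt M x a ∧ Recurrent M (fire M x a) := by
  obtain ⟨y, hy, hl, hr⟩ := hx
  have ht := hl.tight hδ (by rw [hr])
  obtain ⟨y', hy'⟩ := (ht.canStart hM ha (mem_of_cycle hδ hy hl hr a)).exists_commEquiv
  rw [legal_congr x hy'] at hl
  rw [run_congr x hy'] at hr
  refine ⟨(hl.tight hδ (by rw [hr])).1, y' ++ [a], by simp, ?_, ?_⟩
  · refine (legal_append ..).2 ⟨hl.2, ?_⟩
    rw [run_cons] at hr
    rw [hr]
    exact ⟨ha, trivial⟩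
  · rw [run_cons] at hr
    rw [run_append, hr, run_cons, run_nil]

theorem Recurrent.tight_and_run (hM : SimplyLaced M) {x : B → Fin 3} (hx : Recurrent M x)
    {w : List B} (hw : Legal M x w) : Tight M x w ∧ Recurrent M (run M x w) := by
  induction w generalizing x with
  | nil => exact ⟨trivial, hx⟩
  | cons a w ih =>
    have h1 := hx.tightAt_and_fire hδ hM hw.1
    exact ⟨⟨h1.1, (ih h1.2 hw.2).1⟩, (ih h1.2 hw.2).2⟩

omit hδ in
/-- A long word passes twice through the same state. -/
theorem exists_cycle_of_card_le {x : B → Fin 3} {w : List B} (hw : Legal M x w)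
    (hlen : Fintype.card (B → Fin 3) ≤ w.length) : ∃ p y q, w = p ++ (y ++ q) ∧ y ≠ [] ∧
      Legal M (run M x p) y ∧ run M (run M x p) y = run M x p := by
  obtain ⟨i, j, hij, h⟩ := Fintype.exists_ne_map_eq_of_card_lt
    (fun i : Fin (w.length + 1) => run M x (w.take i)) (by simp; simpa using hlen)
  wlog hlt : i < j generalizing i j
  · exact this j i hij.symm h.symm (lt_of_le_of_ne (not_lt.1 hlt) hij.symm)
  have e1 : w.take j = w.take i ++ (w.take j).drop i := by
    conv_lhs => rw [← List.take_append_drop i (w.take j)]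
    rw [List.take_take, min_eq_left (show (i : ℕ) ≤ j from hlt.le)]
  have e2 : w = w.take i ++ ((w.take j).drop i ++ w.drop j) := by
    rw [← List.append_assoc, ← e1, List.take_append_drop]
  refine ⟨_, _, _, e2, ?_, ?_, ?_⟩
  · intro h0
    have := congrArg List.length h0
    have hi := i.2
    have hj := j.2
    simp at this
    omega
  · rw [e2] at hw
    exact ((legal_append ..).1 ((legal_append ..).1 hw).2).1
  · rw [← run_append, ← e1]
    exact h.symm

theorem mem_of_card_le {x : B → Fin 3} {w : List B} (hw : Legal M x w)
    (hlen : Fintype.card (B → Fin 3) ≤ w.length) (a : B) : a ∈ w := by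
  obtain ⟨p, y, q, rfl, hy, h1, h2⟩ := exists_cycle_of_card_le hw hlen
  have := mem_of_cycle hδ hy h1 h2 a
  simp [this]

theorem Recurrent.card_legalTraces_fire (hM : SimplyLaced M) {x : B → Fin 3}
    (hx : Recurrent M x) {a : B} (ha : x a = 2) {ℓ : ℕ} (hℓ : Fintype.card (B → Fin 3) ≤ ℓ) :
    (legalTraces M x (ℓ + 1)).card = (legalTraces M (fire M x a) ℓ).card := by
  rw [← run_nil (M := M) (fire M x a), ← run_cons, ← card_startingWith x [a] (by simp) (by simp)
    (by simpa using ha) ℓ]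
  congr 1
  ext q
  rw [mem_startingWith]
  refine ⟨fun h => ⟨h, ?_⟩, fun h => h.1⟩
  obtain ⟨y, rfl, h1, h2⟩ := mem_legalTraces.1 h
  intro b hb
  rw [List.mem_singleton.1 hb]
  exact ⟨y, rfl, (hx.tight_and_run hδ hM h1).1.canStart hM ha
    (mem_of_card_le hδ h1 (by omega) a)⟩

theorem Recurrent.card_legalTraces_run (hM : SimplyLaced M) {x : B → Fin 3}
    (hx : Recurrent M x) {w : List B} (hw : Legal M x w) {ℓ : ℕ}
    (hℓ : Fintype.card (B → Fin 3) ≤ ℓ) :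
    (legalTraces M x (ℓ + w.length)).card = (legalTraces M (run M x w) ℓ).card := by
  induction w generalizing x with
  | nil => rfl
  | cons a w ih =>
    rw [List.length_cons, ← add_assoc, hx.card_legalTraces_fire hδ hM hw.1 (by omega),
      ih (hx.tightAt_and_fire hδ hM hw.1).2 hw.2, run_cons]

theorem Recurrent.ultPeriodic_of_run (hM : SimplyLaced M) {x : B → Fin 3} (hx : Recurrent M x)
    {w : List B} (hw : Legal M x w) {m : ℕ} (h : UltPeriodic M m (run M x w)) :
    UltPeriodic M m x := by
  obtain ⟨N, hN⟩ := h
  refine ⟨N + Fintype.card (B → Fin 3) + w.length, fun ℓ hℓ => ?_⟩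
  obtain ⟨k, rfl⟩ := Nat.exists_eq_add_of_le' hℓ
  have e : k + (N + Fintype.card (B → Fin 3) + w.length) + m =
    k + (N + Fintype.card (B → Fin 3)) + m + w.length := by ring
  rw [e, ← add_assoc k (N + _), hx.card_legalTraces_run hδ hM hw (by omega),
    hx.card_legalTraces_run hδ hM hw (by omega), hN _ (by omega)]

theorem Recurrent.sum_eq_zero {x : B → Fin 3} (hx : Recurrent M x) :
    ∑ s, (((x s : ℕ) : ℤ) - 1) * δ s = 0 := by
  obtain ⟨y, hy, hl, hr⟩ := hx
  have ht := hl.tight hδ (by rw [hr])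
  obtain ⟨k, hk, hk'⟩ := exists_count_eq hδ hy hl hr
  have h1 := ht.energy
  have h2 : ∀ a, (y.map fun b => cartan M b a).sum = 0 := fun a => by
    have := ht.run_eq a
    rw [hr] at this
    omega
  simp only [h2, List.map_const', List.sum_replicate, smul_zero] at h1
  have h3 : (y.map fun a => ((x a : ℕ) : ℤ) - 1).sum = 0 := by omega
  rw [Finset.sum_list_map_count, Finset.sum_subset (Finset.subset_univ y.toFinset)] at h3
  · simp only [nsmul_eq_mul, hk'] at h3
    have : k * ∑ s, (((x s : ℕ) : ℤ) - 1) * δ s = 0 := by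
      rw [← h3, Finset.mul_sum]
      exact Finset.sum_congr rfl fun s _ => by ring
    exact (mul_eq_zero.1 this).resolve_left hk.ne'
  · intro t _ ht
    rw [List.mem_toFinset] at ht
    simp [List.count_eq_zero_of_not_mem ht]

theorem Recurrent.exists_run_ne_two (hM : SimplyLaced M) {x : B → Fin 3} (hx : Recurrent M x)
    (u : B) : ∃ w, Legal M x w ∧ run M x w u = 2 ∧ ∀ s, s ≠ u → run M x w s ≠ 2 := by
  classical
  let S : Set ℕ := {k | ∃ w, Legal M x w ∧ u ∉ w ∧ w.length = k}
  have hS : ∀ k ∈ S, k < Fintype.card (B → Fin 3) := by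
    rintro _ ⟨w, h1, h2, rfl⟩
    by_contra! h
    exact h2 (mem_of_card_le hδ h1 h u)
  have hb : BddAbove S := ⟨_, fun k hk => (hS k hk).le⟩
  obtain ⟨w, h1, h2, h3⟩ := Nat.sSup_mem (s := S) ⟨0, [], trivial, by simp, rfl⟩ hb
  have h4 : ∀ s, s ≠ u → run M x w s ≠ 2 := by
    intro s hs h
    have : w.length + 1 ≤ sSup S := le_csSup hb
      ⟨w ++ [s], (legal_append ..).2 ⟨h1, h, trivial⟩, by simp [h2, hs.symm], by simp⟩
    omega
  refine ⟨w, h1, ?_, h4⟩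
  obtain ⟨y, hy, hl, -⟩ := (hx.tight_and_run hδ hM h1).2
  cases y with
  | nil => exact absurd rfl hy
  | cons a y =>
    by_cases ha : a = u
    · exact ha ▸ hl.1
    · exact absurd hl.1 (h4 a ha)

/-- A recurrent state leads to a state with a single letter ready, where a single counter is not
at its mean value besides. -/
theorem Recurrent.exists_run_eq (hM : SimplyLaced M) {x : B → Fin 3} (hx : Recurrent M x)
    {u : B} (hu : δ u = 1) : ∃ w e, Legal M x w ∧ e ≠ u ∧ δ e = 1 ∧
      run M x w = fun s => if s = u then 2 else if s = e then 0 else 1 := by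
  obtain ⟨w, hw, h2, h1⟩ := hx.exists_run_ne_two hδ hM u
  have h3 := (hx.tight_and_run hδ hM hw).2.sum_eq_zero hδ
  refine ⟨w, ?_⟩
  generalize run M x w = z at *
  have hz : ∀ s, s ≠ u → (z s : ℕ) ≤ 1 := by
    intro s hs
    have : (z s : ℕ) ≠ 2 := fun h => h1 s hs (Fin.ext h)
    omega
  rw [← Finset.add_sum_erase _ _ (Finset.mem_univ u), h2, hu] at h3
  have h4 : ∑ s ∈ Finset.univ.erase u, (1 - ((z s : ℕ) : ℤ)) * δ s = 1 := by
    have : ∑ s ∈ Finset.univ.erase u, (1 - ((z s : ℕ) : ℤ)) * δ s =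
        - ∑ s ∈ Finset.univ.erase u, (((z s : ℕ) : ℤ) - 1) * δ s := by
      rw [← Finset.sum_neg_distrib]
      exact Finset.sum_congr rfl fun s _ => by ring
    rw [this]
    have h6 : (((2 : Fin 3) : ℕ) : ℤ) = 2 := rfl
    rw [h6] at h3
    linarith
  have hnn : ∀ s ∈ Finset.univ.erase u, 0 ≤ (1 - ((z s : ℕ) : ℤ)) * δ s := by
    intro s hs
    have := hz s (Finset.ne_of_mem_erase hs)
    exact mul_nonneg (by omega) (hδ.pos s).le
  obtain ⟨e, he, hne⟩ : ∃ e ∈ Finset.univ.erase u, (1 - ((z e : ℕ) : ℤ)) * δ e ≠ 0 := by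
    by_contra! h
    rw [Finset.sum_eq_zero h] at h4
    omega
  have heu := Finset.ne_of_mem_erase he
  rw [← Finset.add_sum_erase _ _ he] at h4
  have hrest : 0 ≤ ∑ s ∈ (Finset.univ.erase u).erase e, (1 - ((z s : ℕ) : ℤ)) * δ s :=
    Finset.sum_nonneg fun s hs => hnn s (Finset.mem_of_mem_erase hs)
  have hze : (z e : ℕ) = 0 := by
    have := hz e heu
    by_contra h
    have : (z e : ℕ) = 1 := by omega
    simp [this] at hne
  have hδe := hδ.pos e
  rw [hze] at h4
  simp only [Nat.cast_zero, sub_zero, one_mul] at h4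
  refine ⟨e, hw, heu, by omega, ?_⟩
  have h5 : ∑ s ∈ (Finset.univ.erase u).erase e, (1 - ((z s : ℕ) : ℤ)) * δ s = 0 := by omega
  rw [Finset.sum_eq_zero_iff_of_nonneg fun s hs => hnn s (Finset.mem_of_mem_erase hs)] at h5
  funext s
  by_cases hs : s = u
  · simp [hs, h2]
  by_cases hs' : s = e
  · subst hs'
    simp [hs]
    exact Fin.ext hze
  · have := h5 s (by simp [hs, hs'])
    rcases mul_eq_zero.1 this with h | h
    · simp [hs, hs']
      exact Fin.ext (show (z s : ℕ) = 1 by omega)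
    · exact absurd h (hδ.pos s).ne'

end Recurrence

section Automorphism

variable {B : Type*} [DecidableEq B] {M : CoxeterMatrix B}

theorem fire_comp (φ : B ≃ B) (hφ : ∀ i j, M (φ i) (φ j) = M i j) (x : B → Fin 3) (a : B) :
    fire M (x ∘ φ) a = fire M x (φ a) ∘ φ := by
  funext t
  simp [fire, hφ]

theorem legal_map (φ : B ≃ B) (hφ : ∀ i j, M (φ i) (φ j) = M i j) (x : B → Fin 3) (w : List B) :
    Legal M x (w.map φ) ↔ Legal M (x ∘ φ) w := by
  induction w generalizing x with
  | nil => simp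
  | cons a w ih => simp [ih, fire_comp φ hφ]

theorem card_legalTraces_comp_le [Finite B] (φ : B ≃ B) (hφ : ∀ i j, M (φ i) (φ j) = M i j)
    (x : B → Fin 3) (ℓ : ℕ) :
    (legalTraces M (x ∘ φ) ℓ).card ≤ (legalTraces M x ℓ).card := by
  have hψ : ∀ i j, M (φ.symm i) (φ.symm j) = M i j := fun i j => by rw [← hφ]; simp
  refine Finset.card_le_card_of_injOn
    (Quot.lift (fun y => Trace.mk (y.map φ)) ?_) ?_ ?_
  · intro y y' h
    exact Trace.mk_eq_mk.2 (CommEquiv.map hφ (.rel _ _ h))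
  · rintro ⟨y⟩ h
    have := mk_mem_legalTraces.1 h
    refine mk_mem_legalTraces.2 ⟨(legal_map φ hφ x y).2 this.1, by simpa using this.2⟩
  · rintro ⟨y⟩ - ⟨y'⟩ - h
    have := CommEquiv.map hψ (Trace.mk_eq_mk.1 h)
    simp only [List.map_map, Equiv.symm_comp_self, List.map_id] at this
    exact Trace.mk_eq_mk.2 this

theorem card_legalTraces_comp [Finite B] (φ : B ≃ B) (hφ : ∀ i j, M (φ i) (φ j) = M i j)
    (x : B → Fin 3) (ℓ : ℕ) :
    (legalTraces M (x ∘ φ) ℓ).card = (legalTraces M x ℓ).card := by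
  refine (card_legalTraces_comp_le φ hφ x ℓ).antisymm ?_
  have := card_legalTraces_comp_le φ.symm (fun i j => by rw [← hφ]; simp) (x ∘ φ) ℓ
  simpa [Function.comp_assoc] using this

end Automorphism

section Spaced

variable {B : Type*} (M : CoxeterMatrix B)

/-- The number of letters of a word adjacent to `s`. -/
def neighbourCount (s : B) (w : List B) : ℕ := w.countP fun a => M a s = 3

variable {M}

theorem neighbourCount_append (s : B) (w w' : List B) :
    neighbourCount M s (w ++ w') = neighbourCount M s w + neighbourCount M s w' :=
  List.countP_append ..

theorem neighbourCount_reverse (s : B) (w : List B) :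
    neighbourCount M s w.reverse = neighbourCount M s w := List.countP_reverse ..

theorem neighbourCount_eq_zero {s : B} {w : List B} (h : ∀ a ∈ w, M a s = 2) :
    neighbourCount M s w = 0 := by
  rw [neighbourCount, List.countP_eq_zero]
  intro a ha
  simp [h a ha]

variable [DecidableEq B]

variable (M) in
/-- Every occurrence of `s` in the word is preceded by at least two neighbours of `s` since the
previous occurrence of `s`, where `k` neighbours have been met before the start of the word. -/
def Spaced (s : B) : ℕ → List B → Prop
  | _, [] => True
  | k, a :: w => if a = s then 2 ≤ k ∧ Spaced s 0 w
      else if M a s = 3 then Spaced s (k + 1) w else Spaced s k w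

theorem spaced_of_two_le (s : B) {k : ℕ} (hk : 2 ≤ k) (w : List B) :
    Spaced M s k w ↔ Spaced M s 2 w := by
  induction w generalizing k with
  | nil => rfl
  | cons a w ih =>
    simp only [Spaced]
    split_ifs
    · simp [hk]
    · rw [ih (by omega), ih (k := 3) (by omega)]
    · exact ih hk

theorem legal_iff_spaced (x : B → Fin 3) (w : List B) :
    Legal M x w ↔ ∀ s, Spaced M s (x s : ℕ) w := by
  induction w generalizing x with
  | nil => simp [Spaced]
  | cons a w ih =>
    have key : ∀ s, x a = 2 →
        (Spaced M s (x s : ℕ) (a :: w) ↔ Spaced M s (fire M x a s : ℕ) w) := by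
      intro s hx
      simp only [Spaced, fire, eq_comm (a := s)]
      split_ifs with h1 h2 h3
      · subst h1
        simp [hx]
      · simp [h3]
      · have h4 : (x s : ℕ) ≠ 0 := fun h => h3 (Fin.ext h)
        exact spaced_of_two_le s (by omega) w
      · rfl
    rw [legal_cons, ih]
    constructor
    · rintro ⟨h1, h2⟩ s
      exact (key s h1).2 (h2 s)
    · intro h
      have h1 : x a = 2 := by
        have := h a
        rw [Spaced, if_pos rfl] at this
        have := (x a).2
        apply Fin.ext
        change (x a : ℕ) = 2
        omega
      exact ⟨h1, fun s => (key s h1).1 (h s)⟩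

theorem spaced_of_notMem {s : B} {w : List B} (h : s ∉ w) (k : ℕ) : Spaced M s k w := by
  induction w generalizing k with
  | nil => trivial
  | cons a w ih =>
    simp only [List.mem_cons, not_or] at h
    rw [Spaced, if_neg (Ne.symm h.1)]
    split_ifs <;> exact ih h.2 _

theorem spaced_append_cons {s : B} {q : List B} (h : s ∉ q) (r : List B) (k : ℕ) :
    Spaced M s k (q ++ s :: r) ↔ 2 ≤ k + neighbourCount M s q ∧ Spaced M s 0 r := by
  induction q generalizing k with
  | nil => simp [Spaced, neighbourCount]
  | cons a w ih =>
    simp only [List.mem_cons, not_or] at h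
    rw [List.cons_append, Spaced, if_neg (Ne.symm h.1), ih h.2, ih h.2]
    by_cases h3 : M a s = 3
    · simp [h3, neighbourCount, add_assoc, add_comm]
    · simp [h3, neighbourCount]

theorem spaced_split (s : B) (p r : List B) (k : ℕ) :
    Spaced M s k (p ++ s :: r) ↔ Spaced M s k (p ++ [s]) ∧ Spaced M s 0 r := by
  induction p generalizing k with
  | nil => simp [Spaced]
  | cons a w ih =>
    simp only [List.cons_append, Spaced]
    split_ifs
    · rw [ih, and_assoc]
    · exact ih _
    · exact ih _

theorem spaced_reverse_append (s : B) (r : List B) :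
    Spaced M s 2 (r.reverse ++ [s]) ↔ Spaced M s 0 r := by
  induction hn : r.length using Nat.strong_induction_on generalizing r with
  | _ n ih =>
  by_cases hs : s ∈ r
  · obtain ⟨q, r', rfl, hq⟩ := List.eq_append_cons_of_mem hs
    have := ih r'.length (by simp at hn; omega) r' rfl
    rw [spaced_append_cons hq, List.reverse_append, List.reverse_cons, List.append_assoc,
      List.append_assoc, List.singleton_append, spaced_split, this,
      spaced_append_cons (by simpa using hq), neighbourCount_reverse]
    simp [Spaced, and_comm]
  · rw [spaced_append_cons (by simpa using hs)]
    simp [Spaced, spaced_of_notMem hs]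

variable (M) in
/-- The state from which the right half of a palindromic word with middle part `a` is read. -/
def middleState (a : List B) (s : B) : Fin 3 :=
  if s ∈ a then 0 else if 2 ≤ neighbourCount M s a then 2 else 1

theorem spaced_palindrome {a : List B} (ha : a.Pairwise fun b c => M b c = 2) (s : B)
    (y : List B) :
    Spaced M s 2 (y.reverse ++ (a ++ y)) ↔ Spaced M s (middleState M a s : ℕ) y := by
  have hsa : s ∈ a → ∃ a₁ a₂, a = a₁ ++ s :: a₂ ∧ s ∉ a₁ ∧ s ∉ a₂ ∧
      neighbourCount M s a₁ = 0 ∧ neighbourCount M s a₂ = 0 := by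
    intro h
    obtain ⟨a₁, a₂, rfl, h1⟩ := List.eq_append_cons_of_mem h
    rw [List.pairwise_append, List.pairwise_cons] at ha
    refine ⟨a₁, a₂, rfl, h1, fun h => ?_, neighbourCount_eq_zero fun b hb => ha.2.2 b hb s (by simp),
      neighbourCount_eq_zero fun b hb => ?_⟩
    · have := ha.2.1.1 s h
      simp at this
    · rw [M.symmetric, ha.2.1.1 b hb]
  by_cases hy : s ∈ y
  · obtain ⟨q, r, rfl, hq⟩ := List.eq_append_cons_of_mem hy
    rw [List.reverse_append, List.reverse_cons, List.append_assoc,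
      List.append_assoc, List.singleton_append, spaced_split, spaced_reverse_append,
      spaced_append_cons hq]
    by_cases h : s ∈ a
    · obtain ⟨a₁, a₂, rfl, h1, h2, h3, h4⟩ := hsa h
      have e : q.reverse ++ ((a₁ ++ s :: a₂) ++ (q ++ s :: r)) =
        (q.reverse ++ a₁) ++ s :: ((a₂ ++ q) ++ s :: r) := by simp
      rw [e, spaced_append_cons (by simp [hq, h1]), spaced_append_cons (by simp [hq, h2]),
        neighbourCount_append, neighbourCount_append, h3, h4, neighbourCount_reverse]
      simp only [middleState, if_pos h]
      simp
    · have e : q.reverse ++ (a ++ (q ++ s :: r)) = (q.reverse ++ (a ++ q)) ++ s :: r := by simp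
      rw [e, spaced_append_cons (by simp [hq, h]), neighbourCount_append, neighbourCount_append,
        neighbourCount_reverse]
      simp only [middleState, if_neg h]
      have : (2 ≤ 0 + (neighbourCount M s q + (neighbourCount M s a + neighbourCount M s q))) ↔
          2 ≤ ((if 2 ≤ neighbourCount M s a then 2 else 1 : Fin 3) : ℕ) + neighbourCount M s q := by
        split_ifs
        · exact iff_of_true (by omega) (Nat.le_add_right 2 _)
        · change _ ↔ 2 ≤ 1 + _
          omega
      rw [← this]
      tauto
  · refine iff_of_true ?_ (spaced_of_notMem hy _)
    by_cases h : s ∈ a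
    · obtain ⟨a₁, a₂, rfl, h1, h2, h3, h4⟩ := hsa h
      have e : y.reverse ++ ((a₁ ++ s :: a₂) ++ y) = (y.reverse ++ a₁) ++ s :: (a₂ ++ y) := by simp
      rw [e, spaced_append_cons (by simp [hy, h1])]
      exact ⟨by omega, spaced_of_notMem (by simp [hy, h2]) _⟩
    · exact spaced_of_notMem (by simp [hy, h]) _

theorem legal_palindrome {a : List B} (ha : a.Pairwise fun b c => M b c = 2) (y : List B) :
    Legal M top (y.reverse ++ (a ++ y)) ↔ Legal M (middleState M a) y := by
  rw [legal_iff_spaced, legal_iff_spaced]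
  exact forall_congr' fun s => spaced_palindrome ha s y

end Spaced

section Palindrome

variable {B : Type*} [DecidableEq B] {M : CoxeterMatrix B}

/-- A word equivalent to its reverse is equivalent to a palindrome with a commuting middle part. -/
theorem exists_palindrome {z : List B} (hz : CommEquiv M z z.reverse) :
    ∃ a y : List B, a.Pairwise (fun b c => M b c = 2) ∧
      CommEquiv M z (y.reverse ++ (a ++ y)) := by
  induction hn : z.length using Nat.strong_induction_on generalizing z with
  | _ n ih =>
  cases z with
  | nil => exact ⟨[], [], .nil, .refl _⟩
  | cons s u =>
  have hstart : CanStart M s (u.reverse ++ [s]) := by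
    rw [← List.reverse_cons]
    exact (canStart_congr s hz).1 (.inl rfl)
  have hcases : ∀ l : List B, CanStart M s (l ++ [s]) → CanStart M s l ∨ ∀ c ∈ l, M s c = 2 := by
    intro l
    induction l with
    | nil => simp
    | cons c l ih =>
      rintro (h | ⟨h1, h2⟩)
      · exact .inl (.inl h)
      · rcases ih h2 with h | h
        · exact .inl (.inr ⟨h1, h⟩)
        · right
          simpa using ⟨h1, h⟩
  rw [List.reverse_cons] at hz
  rcases hcases _ hstart with h | h
  · obtain ⟨v, hv⟩ := h.exists_commEquiv
    have hu : CommEquiv M u (v.reverse ++ [s]) := by simpa using hv.reverse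
    have h1 : CommEquiv M (s :: (v.reverse ++ [s])) (s :: v ++ [s]) :=
      ((hu.cons s).symm.trans hz).trans (hv.append_right [s])
    have h2 : CommEquiv M v.reverse v := by
      have : CommEquiv M (s :: v) (s :: v.reverse) := by
        simpa using (CommEquiv.cancel_cons h1).reverse
      exact (CommEquiv.cancel_cons this).symm
    have hlen := hu.perm.length_eq
    obtain ⟨a, y, ha, hy⟩ := ih v.reverse.length (by simp at hn hlen ⊢; omega)
      (z := v.reverse) (by simpa using h2) rfl
    refine ⟨a, y ++ [s], ha, (hu.cons s).trans ?_⟩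
    simpa using (hy.append_right [s]).cons s
  · have h' : ∀ c ∈ u, M s c = 2 := by simpa using h
    have h1 : CommEquiv M (s :: u) (s :: u.reverse) := hz.trans (CommEquiv.move s _ h).symm
    obtain ⟨a, y, ha, hy⟩ := ih u.length (by simp at hn; omega) (CommEquiv.cancel_cons h1) rfl
    have hmem : ∀ c, c ∈ y ∨ c ∈ a → M s c = 2 := fun c hc => by
      refine h' c (hy.perm.mem_iff.2 ?_)
      simp only [List.mem_append, List.mem_reverse]
      tauto
    refine ⟨s :: a, y, List.pairwise_cons.2 ⟨fun c hc => hmem c (.inr hc), ha⟩,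
      (hy.cons s).trans ?_⟩
    simpa using (CommEquiv.move s y.reverse fun c hc => hmem c (by simpa using Or.inl hc)).append_right (a ++ y)

theorem palindrome_right_unique {a y y' : List B}
    (h : CommEquiv M (y.reverse ++ (a ++ y)) (y'.reverse ++ (a ++ y'))) : CommEquiv M y y' := by
  induction y using List.reverseRecOn generalizing y' with
  | nil =>
    have := h.perm.length_eq
    simp at this
    have : y' = [] := List.length_eq_zero_iff.1 (by omega)
    rw [this]
    exact .refl _
  | append_singleton y s ih =>
    have hs : s ∈ y' := by
      have h2 := h.perm.count_eq s
      simp at h2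
      rw [← List.count_pos_iff]
      omega
    have h1 : CanStart M s (y'.reverse ++ (a ++ y')) := (canStart_congr s h).1 (by simp [CanStart])
    have hcases : ∀ l r : List B, s ∈ l → CanStart M s (l ++ r) → CanStart M s l := by
      intro l r hl
      induction l with
      | nil => simp at hl
      | cons c l ih =>
        rintro (h | ⟨h1, h2⟩)
        · exact .inl h
        · refine .inr ⟨h1, ih ?_ h2⟩
          rcases List.mem_cons.1 hl with rfl | hl
          · simp at h1
          · exact hl
    obtain ⟨v, hv⟩ := (hcases _ _ (by simpa using hs) h1).exists_commEquiv
    have hv' : CommEquiv M y' (v.reverse ++ [s]) := by simpa using hv.reverse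
    have h2 : CommEquiv M (s :: (y.reverse ++ (a ++ y)) ++ [s])
        (s :: (v ++ (a ++ v.reverse)) ++ [s]) := by
      have e1 : (y ++ [s]).reverse ++ (a ++ (y ++ [s])) = s :: (y.reverse ++ (a ++ y)) ++ [s] := by
        simp
      rw [e1] at h
      refine (h.trans (hv.append_right _)).trans ?_
      simpa using (hv'.append_left a).append_left (s :: v)
    have h3 : CommEquiv M (s :: (y.reverse ++ (a ++ y)).reverse)
        (s :: (v ++ (a ++ v.reverse)).reverse) := by
      simpa using (CommEquiv.cancel_cons h2).reverse
    have h4 := (CommEquiv.cancel_cons h3).reverse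
    rw [List.reverse_reverse, List.reverse_reverse] at h4
    exact ((ih (y' := v.reverse) (by simpa using h4)).append_right [s]).trans hv'.symm

theorem mem_iff_of_palindrome {a a' y y' : List B} (ha : a.Nodup) (ha' : a'.Nodup)
    (h : CommEquiv M (y.reverse ++ (a ++ y)) (y'.reverse ++ (a' ++ y'))) (s : B) :
    s ∈ a ↔ s ∈ a' := by
  have h1 := h.perm.count_eq s
  have h2 := List.nodup_iff_count_le_one.1 ha s
  have h3 := List.nodup_iff_count_le_one.1 ha' s
  rw [← List.count_pos_iff, ← List.count_pos_iff]
  simp at h1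
  omega

end Palindrome

section Counting

variable {B W : Type*} [Group W] {M : CoxeterMatrix B} (cs : CoxeterSystem M W)

/-- The element of a palindromic word, as a function of its middle part and its right half. -/
def palindromeProd (a : List B) : Trace M → W :=
  Quot.lift (fun y => cs.wordProd (y.reverse ++ (a ++ y))) fun y y' h => by
    have h' : CommEquiv M y y' := Relation.EqvGen.rel _ _ h
    exact ((h'.reverse.append_right _).trans ((h'.append_left a).append_left _)).wordProd_eq cs

theorem palindromeProd_mul_self {a : List B} (ha : a.Pairwise fun b c => M b c = 2)
    (q : Trace M) : palindromeProd cs a q * palindromeProd cs a q = 1 := by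
  obtain ⟨y⟩ := q
  change cs.wordProd (y.reverse ++ (a ++ y)) * cs.wordProd (y.reverse ++ (a ++ y)) = 1
  have h : CommEquiv M (y.reverse ++ (a ++ y)).reverse (y.reverse ++ (a ++ y)) := by
    rw [List.reverse_append, List.reverse_append, List.reverse_reverse, List.append_assoc]
    exact ((CommEquiv.of_perm (List.reverse_perm a).symm ha).symm.append_right y).append_left _
  nth_rw 1 [← h.wordProd_eq cs]
  rw [wordProd_reverse, inv_mul_cancel]

theorem pairwise_comm_nodup {a : List B} (ha : a.Pairwise fun b c => M b c = 2) : a.Nodup :=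
  ha.imp fun {b c} h => by
    rintro rfl
    simp at h

variable [DecidableEq B] (hM : SimplyLaced M)
include hM

theorem exists_eq_palindromeProd {w : W} (hw : IsFCInvolution cs w) :
    ∃ a y : List B, a.Pairwise (fun b c => M b c = 2) ∧
      Legal M top (y.reverse ++ (a ++ y)) ∧ cs.wordProd (y.reverse ++ (a ++ y)) = w := by
  obtain ⟨z, hz, rfl⟩ := cs.exists_isReduced w
  have hl := legal_of_isFullyCommutative cs hM hw.1 hz rfl
  have hr : CommEquiv M z z.reverse := hl.commEquiv cs hM hz.reverse (by
    rw [wordProd_reverse]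
    exact inv_eq_of_mul_eq_one_left hw.2)
  obtain ⟨a, y, ha, hy⟩ := exists_palindrome hr
  exact ⟨a, y, ha, (legal_congr _ hy).1 hl, (hy.wordProd_eq cs).symm⟩

/-- The right halves of the fully commutative involutions of length `L` whose reduced words have
the middle part `A`. -/
def rightHalves (M : CoxeterMatrix B) (L : ℕ) (A : Finset B) : Set (Trace M) :=
  {q | (A.toList.Pairwise fun b c => M b c = 2) ∧ ∃ y, Trace.mk y = q ∧
    Legal M (middleState M A.toList) y ∧ A.card + 2 * y.length = L}

omit hM in
theorem legal_of_mem_rightHalves {L : ℕ} {A : Finset B} {y : List B}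
    (h : Trace.mk y ∈ rightHalves M L A) : Legal M top (y.reverse ++ (A.toList ++ y)) ∧
      (y.reverse ++ (A.toList ++ y)).length = L := by
  obtain ⟨hA, y', hy, hl, hc⟩ := h
  rw [Trace.mk_eq_mk] at hy
  rw [legal_palindrome hA, ← legal_congr _ hy]
  refine ⟨hl, ?_⟩
  have := hy.perm.length_eq
  simp only [List.length_append, List.length_reverse, Finset.length_toList]
  omega

theorem card_fcInvolutions (L : ℕ) :
    Nat.card {w // IsFCInvolution cs w ∧ cs.length w = L} =
      Nat.card (Σ A : Finset B, rightHalves M L A) := by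
  symm
  have hmem : ∀ p : Σ A : Finset B, rightHalves M L A,
      IsFCInvolution cs (palindromeProd cs p.1.toList p.2.1) ∧
        cs.length (palindromeProd cs p.1.toList p.2.1) = L := by
    rintro ⟨A, ⟨⟨y⟩, h⟩⟩
    have h' := legal_of_mem_rightHalves h
    exact ⟨⟨h'.1.isFullyCommutative cs hM, palindromeProd_mul_self cs h.1 _⟩,
      (h'.1.isReduced cs hM).trans h'.2⟩
  refine Nat.card_eq_of_bijective (fun p => ⟨_, hmem p⟩) ⟨?_, ?_⟩
  · rintro ⟨A, ⟨⟨y⟩, h⟩⟩ ⟨A', ⟨⟨y'⟩, h'⟩⟩ heq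
    have h1 := (legal_of_mem_rightHalves h).1
    have h2 := (legal_of_mem_rightHalves h').1
    have he := h1.commEquiv cs hM (h2.isReduced cs hM) (congrArg Subtype.val heq).symm
    obtain rfl : A = A' := by
      ext s
      simpa using mem_iff_of_palindrome A.nodup_toList A'.nodup_toList he s
    have hy : (Trace.mk y : Trace M) = Trace.mk y' :=
      Trace.mk_eq_mk.2 (palindrome_right_unique he)
    exact congrArg (Sigma.mk A) (Subtype.ext hy)
  · rintro ⟨w, hw, hL⟩
    obtain ⟨a, y, ha, hl, rfl⟩ := exists_eq_palindromeProd cs hM hw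
    have hp := List.toFinset_toList (pairwise_comm_nodup ha)
    have ha' : a.toFinset.toList.Pairwise fun b c => M b c = 2 :=
      (hp.symm.pairwise_iff fun {b c} h => by rw [M.symmetric, h]).1 ha
    have he : CommEquiv M (y.reverse ++ (a ++ y)) (y.reverse ++ (a.toFinset.toList ++ y)) :=
      ((CommEquiv.of_perm hp.symm ha).append_right y).append_left _
    have hlen := he.perm.length_eq
    rw [← (hl.isReduced cs hM), hL] at hlen
    rw [legal_congr _ he] at hl
    refine ⟨⟨a.toFinset, Trace.mk y, ha', y, rfl, (legal_palindrome ha' y).1 hl, ?_⟩,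
      Subtype.ext (he.wordProd_eq cs).symm⟩
    simp only [List.length_append, List.length_reverse, Finset.length_toList] at hlen
    omega

omit hM in
theorem rightHalves_eq [Finite B] {A : Finset B} (hA : A.toList.Pairwise fun b c => M b c = 2)
    (ℓ : ℕ) : rightHalves M (A.card + 2 * ℓ) A = legalTraces M (middleState M A.toList) ℓ := by
  ext q
  rw [Finset.mem_coe, mem_legalTraces]
  simp [rightHalves, hA]

omit hM in
theorem rightHalves_eq_empty {L : ℕ} {A : Finset B}
    (h : ¬ ((A.toList.Pairwise fun b c => M b c = 2) ∧ ∃ ℓ, L = A.card + 2 * ℓ)) :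
    rightHalves M L A = ∅ := by
  rw [Set.eq_empty_iff_forall_notMem]
  rintro q ⟨hA, y, -, -, hL⟩
  exact h ⟨hA, _, hL.symm⟩

omit hM in
theorem finite_rightHalves [Finite B] (L : ℕ) (A : Finset B) : (rightHalves M L A).Finite := by
  by_cases h : (A.toList.Pairwise fun b c => M b c = 2) ∧ ∃ ℓ, L = A.card + 2 * ℓ
  · obtain ⟨hA, ℓ, rfl⟩ := h
    rw [rightHalves_eq hA]
    exact Finset.finite_toSet _
  · rw [rightHalves_eq_empty h]
    exact Set.finite_empty

theorem ultimately_periodic_fcInvolutions [Fintype B] {m : ℕ}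
    (h : ∀ x : B → Fin 3, UltPeriodic M m x) : ∃ N : ℕ, ∀ L : ℕ, N ≤ L →
      Nat.card {w // IsFCInvolution cs w ∧ cs.length w = L + 2 * m} =
      Nat.card {w // IsFCInvolution cs w ∧ cs.length w = L} := by
  choose N hN using fun A : Finset B => h (middleState M A.toList)
  refine ⟨∑ A, (A.card + 2 * N A), fun L hL => ?_⟩
  have := fun L A => (finite_rightHalves (M := M) L A).to_subtype
  rw [card_fcInvolutions cs hM, card_fcInvolutions cs hM, Nat.card_sigma, Nat.card_sigma]
  refine Finset.sum_congr rfl fun A _ => ?_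
  have hA := Finset.single_le_sum (f := fun A : Finset B => A.card + 2 * N A)
    (fun _ _ => Nat.zero_le _) (Finset.mem_univ A)
  by_cases hc : (A.toList.Pairwise fun b c => M b c = 2) ∧ ∃ ℓ, L = A.card + 2 * ℓ
  · obtain ⟨hc, ℓ, rfl⟩ := hc
    rw [add_assoc, ← mul_add, rightHalves_eq hc, rightHalves_eq hc]
    simpa using hN A ℓ (by omega)
  · rw [rightHalves_eq_empty hc, rightHalves_eq_empty]
    rintro ⟨h1, ℓ, h2⟩
    exact hc ⟨h1, ℓ - m, by omega⟩

end Counting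

section AffineD

variable {n : ℕ}

theorem simplyLaced_affineD (n : ℕ) : SimplyLaced (affineD n) := by
  intro i j hij
  have h : (i : ℕ) ≠ (j : ℕ) := fun h => hij (Fin.ext h)
  simp only [affineD, Matrix.of_apply]
  split_ifs
  · exact absurd ‹_› h
  · simp
  · simp

theorem affineD_eq_three_iff (hn : 2 ≤ n) (i j : Fin (n + 3)) : affineD n i j = 3 ↔
    ((i : ℕ) < 2 ∧ (j : ℕ) = 2) ∨ ((j : ℕ) < 2 ∧ (i : ℕ) = 2) ∨
    ((i : ℕ) + 1 = j ∧ 2 ≤ (i : ℕ) ∧ (j : ℕ) ≤ n) ∨ ((j : ℕ) + 1 = i ∧ 2 ≤ (j : ℕ) ∧ (i : ℕ) ≤ n) ∨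
    ((i : ℕ) = n ∧ n < (j : ℕ)) ∨ ((j : ℕ) = n ∧ n < (i : ℕ)) := by
  have h1 := i.2
  have h2 := j.2
  simp only [affineD, Matrix.of_apply]
  split_ifs with h h' <;> simp <;> omega

theorem sum_cartan {B : Type*} [Fintype B] [DecidableEq B] (M : CoxeterMatrix B) (a : B)
    (c : B → ℤ) : ∑ t, cartan M a t * c t = 2 * c a - ∑ t with M a t = 3, c t := by
  have : ∀ t, cartan M a t * c t =
      (if t = a then 2 * c t else 0) - (if M a t = 3 then c t else 0) := by
    intro t
    unfold cartan
    split_ifs with h1 h2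
    · subst h1; simp at h2
    all_goals ring
  simp only [this, Finset.sum_sub_distrib, Finset.sum_ite_eq', Finset.mem_univ, if_true,
    Finset.sum_filter]

variable (hn : 2 ≤ n)
include hn

theorem sum_cartan_left (c : Fin (n + 3) → ℤ) (a : Fin (n + 3)) (ha : (a : ℕ) < 2) :
    ∑ t, cartan (affineD n) a t * c t = 2 * c a - c ⟨2, by omega⟩ := by
  have : ({t | affineD n a t = 3} : Finset (Fin (n + 3))) = {⟨2, by omega⟩} := by
    ext t
    have := t.2
    simp only [Finset.mem_filter, Finset.mem_univ, true_and, affineD_eq_three_iff hn,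
      Finset.mem_singleton, Fin.ext_iff]
    omega
  rw [sum_cartan, this, Finset.sum_singleton]

theorem sum_cartan_right (c : Fin (n + 3) → ℤ) (a : Fin (n + 3)) (ha : n < (a : ℕ)) :
    ∑ t, cartan (affineD n) a t * c t = 2 * c a - c ⟨n, by omega⟩ := by
  have : ({t | affineD n a t = 3} : Finset (Fin (n + 3))) = {⟨n, by omega⟩} := by
    ext t
    have := t.2
    simp only [Finset.mem_filter, Finset.mem_univ, true_and, affineD_eq_three_iff hn,
      Finset.mem_singleton, Fin.ext_iff]
    omega
  rw [sum_cartan, this, Finset.sum_singleton]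

theorem sum_cartan_interior (c : Fin (n + 3) → ℤ) (i : ℕ) (h2 : 2 ≤ i) (h3 : i ≤ n) :
    ∑ t, cartan (affineD n) ⟨i, by omega⟩ t * c t = 2 * c ⟨i, by omega⟩ -
      (if i = 2 then c ⟨0, by omega⟩ + c ⟨1, by omega⟩ else c ⟨i - 1, by omega⟩) -
      (if i = n then c ⟨n + 1, by omega⟩ + c ⟨n + 2, by omega⟩ else c ⟨i + 1, by omega⟩) := by
  have : ({t | affineD n ⟨i, by omega⟩ t = 3} : Finset (Fin (n + 3))) =
      (if i = 2 then {⟨0, by omega⟩, ⟨1, by omega⟩} else {⟨i - 1, by omega⟩}) ∪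
      (if i = n then {⟨n + 1, by omega⟩, ⟨n + 2, by omega⟩} else {⟨i + 1, by omega⟩}) := by
    ext t
    have := t.2
    split_ifs <;>
    simp only [Finset.mem_filter, Finset.mem_univ, true_and, affineD_eq_three_iff hn,
      Finset.mem_singleton, Finset.mem_union, Finset.mem_insert, Fin.ext_iff] <;>
    omega
  rw [sum_cartan, this, Finset.sum_union]
  · split_ifs <;> simp [Finset.sum_insert, Fin.ext_iff] <;> ring
  · rw [Finset.disjoint_left]
    intro t
    split_ifs <;> simp only [Finset.mem_singleton, Finset.mem_insert, Fin.ext_iff] <;> omega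

omit hn in
/-- The null root of the affine root system of type `D̃`. -/
def nullRootD (n : ℕ) (a : Fin (n + 3)) : ℤ := if 2 ≤ (a : ℕ) ∧ (a : ℕ) ≤ n then 2 else 1

theorem isNullRoot_affineD : IsNullRoot (affineD n) (nullRootD n) where
  pos a := by
    unfold nullRootD
    split_ifs <;> norm_num
  sum_eq_zero a := by
    rcases lt_or_ge (a : ℕ) 2 with h | h
    · rw [sum_cartan_left hn _ a h]
      simp [nullRootD, hn, show ¬ 2 ≤ (a : ℕ) by omega]
    rcases lt_or_ge n (a : ℕ) with h' | h'
    · rw [sum_cartan_right hn _ a h']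
      simp [nullRootD, hn, show ¬ (a : ℕ) ≤ n by omega]
    · refine (sum_cartan_interior hn _ a h h').trans ?_
      simp only [nullRootD]
      split_ifs <;> omega
  exists_eq c hc := by
    have e0 := hc ⟨0, by omega⟩
    have e1 := hc ⟨1, by omega⟩
    have en1 := hc ⟨n + 1, by omega⟩
    have en2 := hc ⟨n + 2, by omega⟩
    rw [sum_cartan_left hn _ _ (by simp)] at e0 e1
    rw [sum_cartan_right hn _ _ (by simp)] at en1 en2
    have key : ∀ i, 2 ≤ i → ∀ h : i ≤ n, c ⟨i, by omega⟩ = 2 * c ⟨0, by omega⟩ := by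
      intro i
      induction i using Nat.strong_induction_on with
      | _ i ih =>
      intro h2 h
      rcases eq_or_lt_of_le h2 with rfl | h2
      · omega
      have e := hc ⟨i - 1, by omega⟩
      rw [sum_cartan_interior hn _ _ (by omega) (by omega), if_neg (show i - 1 ≠ n by omega)] at e
      have h4 := ih (i - 1) (by omega) (by omega) (by omega)
      have h5 : c ⟨i - 1 + 1, by omega⟩ = c ⟨i, by omega⟩ := by congr 2; omega
      split_ifs at e with h6
      · omega
      · have h7 := ih (i - 1 - 1) (by omega) (by omega) (by omega)
        omega
    have hnn := key n hn le_rfl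
    refine ⟨c ⟨0, by omega⟩, fun t => ?_⟩
    have ht := t.2
    unfold nullRootD
    split_ifs with h
    · rw [mul_comm]; exact key t h.1 h.2
    · have : t = ⟨0, by omega⟩ ∨ t = ⟨1, by omega⟩ ∨ t = ⟨n + 1, by omega⟩ ∨
          t = ⟨n + 2, by omega⟩ := by
        simp only [Fin.ext_iff]
        omega
      rcases this with h | h | h | h <;> rw [h] <;> omega

omit hn in
/-- A state with the letter `0` ready and the counter of `e` too small. -/
def startState (e : ℕ) (s : Fin (n + 3)) : Fin 3 :=
  if (s : ℕ) = 0 then 2 else if (s : ℕ) = e then 0 else 1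

omit hn in
/-- The state reached from `startState e` after reading `0, 2, …, i`. -/
def sweepState (e i : ℕ) (s : Fin (n + 3)) : Fin 3 :=
  if (s : ℕ) = 0 then 1 else if (s : ℕ) = 1 then (if e = 1 then 1 else 2)
  else if (s : ℕ) = i then 0 else if i < n ∧ (s : ℕ) = i + 1 then 2
  else if i = n ∧ n < (s : ℕ) then (if (s : ℕ) = e then 1 else 2)
  else if (s : ℕ) = e then 0 else 1

theorem fire_sweepState {e i : ℕ} (he : e = 1 ∨ n < e) (hi : 2 ≤ i) (hin : i < n) :
    fire (affineD n) (sweepState e i) ⟨i + 1, by omega⟩ = sweepState e (i + 1) := by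
  funext t
  have := t.2
  simp only [fire, affineD_eq_three_iff hn, sweepState, Fin.ext_iff (n := n + 3)]
  split_ifs <;> first | rfl | omega

theorem exists_sweep {e : ℕ} (he : e = 1 ∨ n < e) (i : ℕ) (hi : 2 ≤ i) (hin : i ≤ n) :
    ∃ w : List (Fin (n + 3)), w.length = i ∧ Legal (affineD n) (startState e) w ∧
      run (affineD n) (startState e) w = sweepState e i := by
  induction i, hi using Nat.le_induction with
  | base =>
    refine ⟨[⟨0, by omega⟩, ⟨2, by omega⟩], rfl, ⟨rfl, ?_, trivial⟩, ?_⟩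
    · simp only [fire, affineD_eq_three_iff hn, startState, Fin.ext_iff (n := n + 3)]
      split_ifs <;> first
      | rfl
      | contradiction
      | (exfalso; omega)
      | (exfalso
         simp only [true_and, and_true, false_and, and_false, true_or, or_true, false_or, or_false,
           not_true_eq_false, not_false_eq_true] at *
         omega)
    · funext t
      have := t.2
      simp only [run_cons, run_nil, fire, affineD_eq_three_iff hn, startState, sweepState,
        Fin.ext_iff (n := n + 3)]
      split_ifs <;> first
      | rfl
      | contradiction
      | (exfalso; omega)
      | (exfalso
         simp only [true_and, and_true, false_and, and_false, true_or, or_true, false_or, or_false,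
           not_true_eq_false, not_false_eq_true] at *
         omega)
  | succ i hi ih =>
    obtain ⟨w, h1, h2, h3⟩ := ih (by omega)
    refine ⟨w ++ [⟨i + 1, by omega⟩], by simp [h1], (legal_append ..).2 ⟨h2, ?_, trivial⟩, ?_⟩
    · rw [h3]
      simp only [sweepState]
      split_ifs <;> first
      | rfl
      | contradiction
      | (exfalso; omega)
      | (exfalso
         simp only [true_and, and_true, false_and, and_false, true_or, or_true, false_or, or_false,
           not_true_eq_false, not_false_eq_true] at *
         omega)
    · rw [run_append, h3, run_cons, run_nil, fire_sweepState hn he hi (by omega)]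

/-- Exchanging the two leaves at either end of the diagram. -/
def swapLeaves : Fin (n + 3) ≃ Fin (n + 3) where
  toFun i := ⟨if (i : ℕ) = 0 then 1 else if (i : ℕ) = 1 then 0 else if (i : ℕ) = n + 1 then n + 2
    else if (i : ℕ) = n + 2 then n + 1 else i, by have := i.2; split_ifs <;> first | contradiction | omega⟩
  invFun i := ⟨if (i : ℕ) = 0 then 1 else if (i : ℕ) = 1 then 0 else if (i : ℕ) = n + 1 then n + 2
    else if (i : ℕ) = n + 2 then n + 1 else i, by have := i.2; split_ifs <;> first | contradiction | omega⟩
  left_inv i := by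
    ext
    have := i.2
    dsimp only
    split_ifs <;> first | contradiction | omega
  right_inv i := by
    ext
    have := i.2
    dsimp only
    split_ifs <;> first | contradiction | omega

/-- Exchanging the two ends of the diagram. -/
def swapEnds : Fin (n + 3) ≃ Fin (n + 3) where
  toFun i := ⟨if (i : ℕ) ≤ 1 then i + (n + 1) else if (i : ℕ) ≤ n then n + 2 - i
    else i - (n + 1), by have := i.2; split_ifs <;> first | contradiction | omega⟩
  invFun i := ⟨if (i : ℕ) ≤ 1 then i + (n + 1) else if (i : ℕ) ≤ n then n + 2 - i
    else i - (n + 1), by have := i.2; split_ifs <;> first | contradiction | omega⟩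
  left_inv i := by
    ext
    have := i.2
    dsimp only
    split_ifs <;> first | contradiction | omega
  right_inv i := by
    ext
    have := i.2
    dsimp only
    split_ifs <;> first | contradiction | omega

omit hn in
theorem coxeterMatrix_eq_of_three {B : Type*} {M : CoxeterMatrix B} (hM : SimplyLaced M)
    (φ : B ≃ B) (h : ∀ i j, M (φ i) (φ j) = 3 ↔ M i j = 3) (i j : B) : M (φ i) (φ j) = M i j := by
  rcases eq_or_ne i j with rfl | hij
  · simp
  have h1 := h i j
  have h2 := hM i j hij
  have h3 := hM _ _ (φ.injective.ne hij)
  omega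

theorem swapLeaves_cases (i : Fin (n + 3)) : (i : ℕ) = 0 ∧ (swapLeaves hn i : ℕ) = 1 ∨
    (i : ℕ) = 1 ∧ (swapLeaves hn i : ℕ) = 0 ∨ (i : ℕ) = n + 1 ∧ (swapLeaves hn i : ℕ) = n + 2 ∨
    (i : ℕ) = n + 2 ∧ (swapLeaves hn i : ℕ) = n + 1 ∨
    2 ≤ (i : ℕ) ∧ (i : ℕ) ≤ n ∧ (swapLeaves hn i : ℕ) = i := by
  have := i.2
  simp only [swapLeaves, Equiv.coe_fn_mk]
  split_ifs <;> omega

theorem swapEnds_cases (i : Fin (n + 3)) :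
    (i : ℕ) ≤ 1 ∧ (swapEnds hn i : ℕ) = i + (n + 1) ∨
    n < (i : ℕ) ∧ (swapEnds hn i : ℕ) + (n + 1) = i ∨
    2 ≤ (i : ℕ) ∧ (i : ℕ) ≤ n ∧ (swapEnds hn i : ℕ) + i = n + 2 := by
  have := i.2
  simp only [swapEnds, Equiv.coe_fn_mk]
  split_ifs <;> omega

theorem affineD_swapLeaves (i j : Fin (n + 3)) :
    affineD n (swapLeaves hn i) (swapLeaves hn j) = affineD n i j := by
  refine coxeterMatrix_eq_of_three (simplyLaced_affineD n) _ (fun i j => ?_) i j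
  have := i.2
  have := j.2
  have hi := swapLeaves_cases hn i
  have hj := swapLeaves_cases hn j
  simp only [affineD_eq_three_iff hn]
  omega

theorem affineD_swapEnds (i j : Fin (n + 3)) :
    affineD n (swapEnds hn i) (swapEnds hn j) = affineD n i j := by
  refine coxeterMatrix_eq_of_three (simplyLaced_affineD n) _ (fun i j => ?_) i j
  have := i.2
  have := j.2
  have hi := swapEnds_cases hn i
  have hj := swapEnds_cases hn j
  simp only [affineD_eq_three_iff hn]
  omega

theorem fire_sweepState_last {e b : ℕ} (he : e = 1 ∨ n < e) (hb : n < b) (hb' : b < n + 3) (t : Fin (n + 3)) :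
    fire (affineD n) (sweepState e n) ⟨b, hb'⟩ t =
      if (t : ℕ) = 0 then 1 else if (t : ℕ) = 1 then (if e = 1 then 1 else 2)
      else if (t : ℕ) < n then 1 else if (t : ℕ) = n then 1 else if (t : ℕ) = b then 0
      else if (t : ℕ) = e then 1 else 2 := by
  have := t.2
  have h1 : affineD n ⟨b, hb'⟩ t = 3 ↔ (t : ℕ) = n := by
    simp only [affineD_eq_three_iff hn]
    omega
  simp only [fire, h1, sweepState, Fin.ext_iff (n := n + 3)]
  split_ifs <;> first
      | rfl
      | contradiction
      | (exfalso; omega)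
      | (exfalso
         simp only [true_and, and_true, false_and, and_false, true_or, or_true, false_or, or_false,
           not_true_eq_false, not_false_eq_true] at *
         omega)

theorem exists_automorphism {e : ℕ} (he : e = 1 ∨ e = n + 1 ∨ e = n + 2) :
    ∃ (w : List (Fin (n + 3))) (φ : Fin (n + 3) ≃ Fin (n + 3)), w.length = n + 1 ∧
      Legal (affineD n) (startState e) w ∧ (∀ i j, affineD n (φ i) (φ j) = affineD n i j) ∧
      run (affineD n) (startState e) w = startState e ∘ φ := by
  obtain ⟨w, h1, h2, h3⟩ := exists_sweep (e := e) hn (by omega) n hn le_rfl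
  have key : ∀ b : ℕ, n < b → ∀ hb : b < n + 3, b ≠ e →
      Legal (affineD n) (startState e) (w ++ [⟨b, hb⟩]) ∧
      run (affineD n) (startState e) (w ++ [⟨b, hb⟩]) =
        fire (affineD n) (sweepState e n) ⟨b, hb⟩ := by
    intro b hb hb' hbe
    rw [legal_append, run_append, h3]
    refine ⟨⟨h2, ?_, trivial⟩, rfl⟩
    simp only [sweepState]
    split_ifs <;> first
      | rfl
      | contradiction
      | (exfalso; omega)
      | (exfalso
         simp only [true_and, and_true, false_and, and_false, true_or, or_true, false_or, or_false,
           not_true_eq_false, not_false_eq_true] at *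
         omega)
  by_cases h : e = 1
  · obtain ⟨k1, k2⟩ := key (n + 2) (by omega) (by omega) (by omega)
    refine ⟨_, swapEnds hn, by simp [h1], k1, affineD_swapEnds hn, k2.trans ?_⟩
    funext t
    have := t.2
    have := swapEnds_cases hn t
    rw [fire_sweepState_last hn (by omega) (by omega)]
    simp only [startState, Function.comp_apply]
    split_ifs <;> first | rfl | contradiction | (exfalso; omega)
  · obtain ⟨k1, k2⟩ := key (2 * n + 3 - e) (by omega) (by omega) (by omega)
    refine ⟨_, swapLeaves hn, by simp [h1], k1, affineD_swapLeaves hn, k2.trans ?_⟩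
    funext t
    have := t.2
    have := swapLeaves_cases hn t
    rw [fire_sweepState_last hn (by omega) (by omega)]
    simp only [startState, Function.comp_apply]
    split_ifs <;> first | rfl | contradiction | (exfalso; omega)

theorem ultPeriodic_affineD (x : Fin (n + 3) → Fin 3) :
    UltPeriodic (affineD n) (n + 1) x := by
  have hM := simplyLaced_affineD n
  have hδ := isNullRoot_affineD hn
  refine ultPeriodic_of_recurrent (fun x hx => ?_) x
  obtain ⟨w, e, hw, he, heδ, hr⟩ := hx.exists_run_eq hδ hM (u := ⟨0, by omega⟩) (by
    simp [nullRootD])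
  refine hx.ultPeriodic_of_run hδ hM hw ?_
  have hrec := (hx.tight_and_run hδ hM hw).2
  have hst : run (affineD n) x w = startState (e : ℕ) := by
    rw [hr]
    funext s
    simp only [startState, Fin.ext_iff (n := n + 3)]
  rw [hst] at hrec ⊢
  have := e.2
  obtain ⟨z, φ, hz, hl, hφ, hφ'⟩ := exists_automorphism hn (e := e) (by
    simp only [Fin.ext_iff, ne_eq] at he
    simp only [nullRootD] at heδ
    split_ifs at heδ
    · omega
    · omega)
  refine ⟨Fintype.card (Fin (n + 3) → Fin 3), fun ℓ hℓ => ?_⟩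
  rw [← hz, hrec.card_legalTraces_run hδ hM hl hℓ, hφ', card_legalTraces_comp φ hφ]

end AffineD

end FullyCommutative

/-- For `n ≥ 2`, the number `a(L)` of fully commutative involutions of Coxeter length
`L` in the affine Coxeter group of type `D̃_{n+2}` is ultimately periodic with period
dividing `2n + 2`: there exists `N` such that `a(L + 2n + 2) = a(L)` for all `L ≥ N`. -/
theorem ultimately_periodic_fcInvolutions_affineD (n : ℕ) (hn : 2 ≤ n) :
    ∃ N : ℕ, ∀ L : ℕ, N ≤ L →
      Nat.card {w : (affineD n).Group //
        IsFCInvolution (affineD n).toCoxeterSystem w ∧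
        (affineD n).toCoxeterSystem.length w = L + (2 * n + 2)} =
      Nat.card {w : (affineD n).Group //
        IsFCInvolution (affineD n).toCoxeterSystem w ∧
        (affineD n).toCoxeterSystem.length w = L} := by
  exact FullyCommutative.ultimately_periodic_fcInvolutions (m := n + 1) _
    (FullyCommutative.simplyLaced_affineD n) (FullyCommutative.ultPeriodic_affineD hn)
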